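/- arXiv:1108.5603 — 3 statements merged into one kernel-verified Lean document; each statement's English description precedes it below -/
import Mathlib

section
/- Let n and N be positive integers with N ≤ 2^n, let s be an integer with 2 ≤ s ≤ 2^(n−1), and let r be the unique integer with ∑_{k=r+1}^n C(n,k) ≤ N < ∑_{k=r}^n C(n,k); assume r < n/2 − 1. Suppose 𝓐 is a family of subsets of [n] with |𝓐| = N such that [n]^(≥r+1) is not contained in 𝓐. Then there exists a family 𝓐' of subsets of [n] with |𝓐'| = N and |𝕀^(s)(𝓐')| > |𝕀^(s)(𝓐)|. -/
open Finset

/-- The ground set `[n] = {1, …, n}`. -/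
def groundSet (n : ℕ) : Finset ℕ := Finset.Icc 1 n

/-- All subsets of `[n]`. -/
def allFams (n : ℕ) : Finset (Finset ℕ) := (groundSet n).powerset

/-- `[n]^(≥ r)`: subsets of `[n]` of size at least `r`. -/
def layerGE (n r : ℕ) : Finset (Finset ℕ) := (allFams n).filter fun A => r ≤ A.card

/-- `[n]^(r)`: subsets of `[n]` of size exactly `r`. -/
def layerEQ (n r : ℕ) : Finset (Finset ℕ) := (groundSet n).powersetCard r

/-- `𝕀^(s)(𝓐)`: the intersecting subfamilies of `𝓐` of size `s`. -/
def interFams (s : ℕ) (𝓐 : Finset (Finset ℕ)) : Finset (Finset (Finset ℕ)) :=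
  (𝓐.powersetCard s).filter fun 𝓔 => ∀ B ∈ 𝓔, ∀ B' ∈ 𝓔, (B ∩ B').Nonempty

/-- Shift a set along `f` and add the point `v`. -/
def shiftInsert {α : Type*} [DecidableEq α] (f : α → α) (v : α) (X : Finset α) : Finset α :=
  insert v (X.image f)

/-- The members of `𝓐` avoiding `v` whose shift is missing from `𝓐`. -/
def unshifted {α : Type*} [DecidableEq α] (f : α → α) (v : α) (𝓐 : Finset (Finset α)) :
    Finset (Finset α) :=
  𝓐.filter fun X => v ∉ X ∧ shiftInsert f v X ∉ 𝓐

/-- The compression of `𝓐`: every set avoiding `v` is replaced by its shift, if that is missing. -/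
def compress {α : Type*} [DecidableEq α] (f : α → α) (v : α) (𝓐 : Finset (Finset α)) :
    Finset (Finset α) :=
  (𝓐 \ unshifted f v 𝓐) ∪ (unshifted f v 𝓐).image (shiftInsert f v)

/-- The sets that are forced to move when the sets of `𝓓` move, among those satisfying `T`. -/
inductive Forced {α : Type*} [DecidableEq α] (f : α → α) (v : α) (𝓓 : Finset (Finset α))
    (T : Finset α → Prop) : Finset α → Prop
  | base {X : Finset α} : X ∈ 𝓓 → T X → Forced f v 𝓓 T X
  | step {X Y : Finset α} : Forced f v 𝓓 T Y → T X → v ∉ X → Disjoint (shiftInsert f v Y) X →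
      Forced f v 𝓓 T X

open Classical in
/-- The compression of a subfamily `S` of `𝓐`. -/
noncomputable def compressSub {α : Type*} [DecidableEq α] (f : α → α) (v : α)
    (𝓐 S : Finset (Finset α)) : Finset (Finset α) :=
  S.image fun X => if Forced f v (unshifted f v 𝓐) (· ∈ S) X then shiftInsert f v X else X

section Compression

variable {α : Type*} [DecidableEq α] {f : α → α} {v : α}

lemma mem_shiftInsert_self (X : Finset α) : v ∈ shiftInsert f v X := mem_insert_self _ _

lemma shiftInsert_erase (hf : Function.Involutive f) (hv : f v = v) {X : Finset α} (hX : v ∉ X) :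
    (shiftInsert f v X).erase v = X.image f := by
  apply erase_insert
  intro h
  obtain ⟨x, hx, hxv⟩ := mem_image.1 h
  have : x = v := by rw [← hf x, hxv, hv]
  exact hX (this ▸ hx)

lemma card_shiftInsert (hf : Function.Involutive f) (hv : f v = v) {X : Finset α} (hX : v ∉ X) :
    (shiftInsert f v X).card = X.card + 1 := by
  rw [← card_image_of_injective X hf.injective, ← shiftInsert_erase hf hv hX,
    card_erase_add_one (mem_shiftInsert_self X)]

lemma shiftInsert_inj (hf : Function.Involutive f) (hv : f v = v) {X Y : Finset α} (hX : v ∉ X)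
    (hY : v ∉ Y) (h : shiftInsert f v X = shiftInsert f v Y) : X = Y := by
  apply image_injective hf.injective
  rw [← shiftInsert_erase hf hv hX, ← shiftInsert_erase hf hv hY, h]

lemma disjoint_image_comm (hf : Function.Involutive f) {X Y : Finset α} :
    Disjoint (X.image f) Y ↔ Disjoint X (Y.image f) := by
  simp only [disjoint_left, mem_image]
  constructor
  · rintro h x hx ⟨y, hy, rfl⟩
    exact h ⟨_, hx, hf y⟩ hy
  · rintro h _ ⟨x, hx, rfl⟩ hy
    exact h hx ⟨_, hy, hf x⟩

lemma disjoint_shiftInsert_comm (hf : Function.Involutive f) {X Y : Finset α} (hX : v ∉ X)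
    (hY : v ∉ Y) :
    Disjoint (shiftInsert f v X) Y ↔ Disjoint X (shiftInsert f v Y) := by
  simp [shiftInsert, disjoint_insert_left, disjoint_insert_right, hX, hY, disjoint_image_comm hf]

lemma mem_unshifted {𝓐 : Finset (Finset α)} {X : Finset α} :
    X ∈ unshifted f v 𝓐 ↔ X ∈ 𝓐 ∧ v ∉ X ∧ shiftInsert f v X ∉ 𝓐 := by
  simp [unshifted]

lemma disjoint_shifted (𝓐 : Finset (Finset α)) :
    Disjoint (𝓐 \ unshifted f v 𝓐) ((unshifted f v 𝓐).image (shiftInsert f v)) := by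
  rw [disjoint_right]
  intro Y hY hY'
  obtain ⟨X, hX, rfl⟩ := mem_image.1 hY
  exact (mem_unshifted.1 hX).2.2 (mem_sdiff.1 hY').1

lemma injOn_shiftInsert (hf : Function.Involutive f) (hv : f v = v) (𝓐 : Finset (Finset α)) :
    Set.InjOn (shiftInsert f v) (unshifted f v 𝓐 : Set (Finset α)) := fun _ hX _ hY h =>
  shiftInsert_inj hf hv (mem_unshifted.1 hX).2.1 (mem_unshifted.1 hY).2.1 h

lemma unshifted_subset (𝓐 : Finset (Finset α)) : unshifted f v 𝓐 ⊆ 𝓐 := filter_subset _ _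

lemma card_compress (hf : Function.Involutive f) (hv : f v = v) (𝓐 : Finset (Finset α)) :
    (compress f v 𝓐).card = 𝓐.card := by
  rw [compress, card_union_of_disjoint (disjoint_shifted 𝓐),
    card_image_of_injOn (injOn_shiftInsert hf hv 𝓐),
    card_sdiff_add_card_eq_card (unshifted_subset 𝓐)]

lemma sum_card_compress (hf : Function.Involutive f) (hv : f v = v) (𝓐 : Finset (Finset α)) :
    ∑ X ∈ compress f v 𝓐, X.card = ∑ X ∈ 𝓐, X.card + (unshifted f v 𝓐).card := by
  rw [compress, sum_union (disjoint_shifted 𝓐), sum_image (injOn_shiftInsert hf hv 𝓐),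
    sum_congr rfl fun X hX => card_shiftInsert hf hv (mem_unshifted.1 hX).2.1, sum_add_distrib,
    ← sum_sdiff (unshifted_subset (f := f) (v := v) 𝓐)]
  simp [add_assoc]

lemma Forced.mem {𝓓 : Finset (Finset α)} {T : Finset α → Prop} {X : Finset α}
    (h : Forced f v 𝓓 T X) : T X := by
  cases h <;> assumption

lemma Forced.notMem {𝓐 : Finset (Finset α)} {T : Finset α → Prop} {X : Finset α}
    (h : Forced f v (unshifted f v 𝓐) T X) : v ∉ X := by
  cases h with
  | base h _ => exact (mem_unshifted.1 h).2.1
  | step _ _ h _ => exact h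

lemma Forced.shiftInsert_notMem (hf : Function.Involutive f) {𝓐 S : Finset (Finset α)}
    (hS : S ⊆ 𝓐) (hI : ∀ B ∈ S, ∀ B' ∈ S, (B ∩ B').Nonempty) {X : Finset α}
    (h : Forced f v (unshifted f v 𝓐) (· ∈ S) X) : shiftInsert f v X ∉ S := by
  cases h with
  | base h _ => exact fun h' => (mem_unshifted.1 h).2.2 (hS h')
  | step hY hX hv hd =>
    intro h'
    have := hI _ hY.mem _ h'
    rw [← not_disjoint_iff_nonempty_inter] at this
    exact this ((disjoint_shiftInsert_comm hf hY.notMem hv).1 hd)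

lemma mem_compressSub {𝓐 S : Finset (Finset α)} {Y : Finset α} :
    Y ∈ compressSub f v 𝓐 S ↔
      (∃ X, Forced f v (unshifted f v 𝓐) (· ∈ S) X ∧ shiftInsert f v X = Y) ∨
        (Y ∈ S ∧ ¬ Forced f v (unshifted f v 𝓐) (· ∈ S) Y) := by
  simp only [compressSub, mem_image]
  constructor
  · rintro ⟨X, hX, rfl⟩
    split_ifs with h
    · exact Or.inl ⟨X, h, rfl⟩
    · exact Or.inr ⟨hX, h⟩
  · rintro (⟨X, h, rfl⟩ | ⟨hY, h⟩)
    · exact ⟨X, h.mem, if_pos h⟩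
    · exact ⟨Y, hY, if_neg h⟩

lemma compressSub_subset {𝓐 S : Finset (Finset α)} (hS : S ⊆ 𝓐) :
    compressSub f v 𝓐 S ⊆ compress f v 𝓐 := by
  intro Y hY
  rw [compress, mem_union, mem_sdiff]
  obtain ⟨X, h, rfl⟩ | ⟨hY, h⟩ := mem_compressSub.1 hY
  · by_cases hX : X ∈ unshifted f v 𝓐
    · exact Or.inr (mem_image_of_mem _ hX)
    · have : shiftInsert f v X ∈ 𝓐 := by
        by_contra h'
        exact hX (mem_unshifted.2 ⟨hS h.mem, h.notMem, h'⟩)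
      exact Or.inl ⟨this, fun h' => (mem_unshifted.1 h').2.1 (mem_shiftInsert_self X)⟩
  · exact Or.inl ⟨hS hY, fun h' => h (Forced.base h' hY)⟩

lemma card_compressSub (hf : Function.Involutive f) (hv : f v = v) {𝓐 S : Finset (Finset α)}
    (hS : S ⊆ 𝓐) (hI : ∀ B ∈ S, ∀ B' ∈ S, (B ∩ B').Nonempty) :
    (compressSub f v 𝓐 S).card = S.card := by
  apply card_image_of_injOn
  intro X hX Y hY h
  simp only at h
  split_ifs at h with h1 h2 h2
  · exact shiftInsert_inj hf hv h1.notMem h2.notMem h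
  · exact absurd (h ▸ hY) (h1.shiftInsert_notMem hf hS hI)
  · exact absurd (h ▸ hX) (h2.shiftInsert_notMem hf hS hI)
  · exact h

lemma intersecting_compressSub {𝓐 S : Finset (Finset α)}
    (hI : ∀ B ∈ S, ∀ B' ∈ S, (B ∩ B').Nonempty) :
    ∀ B ∈ compressSub f v 𝓐 S, ∀ B' ∈ compressSub f v 𝓐 S, (B ∩ B').Nonempty := by
  have key : ∀ X Y, Forced f v (unshifted f v 𝓐) (· ∈ S) X → Y ∈ S →
      ¬ Forced f v (unshifted f v 𝓐) (· ∈ S) Y → (shiftInsert f v X ∩ Y).Nonempty := by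
    intro X Y hX hY hY'
    by_cases hvY : v ∈ Y
    · exact ⟨v, mem_inter.2 ⟨mem_shiftInsert_self X, hvY⟩⟩
    · rw [← not_disjoint_iff_nonempty_inter]
      exact fun h => hY' (Forced.step hX hY hvY h)
  intro B hB B' hB'
  obtain ⟨X, hX, rfl⟩ | ⟨hX, hX'⟩ := mem_compressSub.1 hB <;>
  obtain ⟨Y, hY, rfl⟩ | ⟨hY, hY'⟩ := mem_compressSub.1 hB'
  · exact ⟨v, mem_inter.2 ⟨mem_shiftInsert_self X, mem_shiftInsert_self Y⟩⟩
  · exact key _ _ hX hY hY'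
  · rw [inter_comm]
    exact key _ _ hY hX hX'
  · exact hI _ hX _ hY

/-- The forced sets can be read off from the compressed subfamily. -/
lemma forced_iff (hf : Function.Involutive f) (hv : f v = v) {𝓐 S : Finset (Finset α)}
    (hS : S ⊆ 𝓐) (hI : ∀ B ∈ S, ∀ B' ∈ S, (B ∩ B').Nonempty) {X : Finset α} :
    Forced f v (unshifted f v 𝓐) (· ∈ S) X ↔
      Forced f v (unshifted f v 𝓐) (fun X => shiftInsert f v X ∈ compressSub f v 𝓐 S) X := by
  constructor
  · intro h
    induction h with
    | base h1 h2 => exact Forced.base h1 (mem_compressSub.2 (Or.inl ⟨_, Forced.base h1 h2, rfl⟩))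
    | step h1 h2 h3 h4 ih =>
      exact Forced.step ih (mem_compressSub.2 (Or.inl ⟨_, Forced.step h1 h2 h3 h4, rfl⟩)) h3 h4
  · intro h
    induction h with
    | base h1 h2 =>
      obtain ⟨Y, hY, h⟩ | ⟨h, -⟩ := mem_compressSub.1 h2
      · exact shiftInsert_inj hf hv hY.notMem (mem_unshifted.1 h1).2.1 h ▸ hY
      · exact absurd (hS h) (mem_unshifted.1 h1).2.2
    | step h1 h2 h3 h4 ih =>
      obtain ⟨Y, hY, h⟩ | ⟨h, -⟩ := mem_compressSub.1 h2
      · exact shiftInsert_inj hf hv hY.notMem h3 h ▸ hY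
      · have := hI _ ih.mem _ h
        rw [← not_disjoint_iff_nonempty_inter] at this
        exact absurd ((disjoint_shiftInsert_comm hf ih.notMem h3).1 h4) this

lemma mem_iff_of_compressSub (hf : Function.Involutive f) (hv : f v = v)
    {𝓐 S : Finset (Finset α)} (hS : S ⊆ 𝓐) (hI : ∀ B ∈ S, ∀ B' ∈ S, (B ∩ B').Nonempty)
    {X : Finset α} :
    X ∈ S ↔
      Forced f v (unshifted f v 𝓐) (fun X => shiftInsert f v X ∈ compressSub f v 𝓐 S) X ∨
      (X ∈ compressSub f v 𝓐 S ∧ ¬ ∃ Y, Forced f v (unshifted f v 𝓐)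
        (fun X => shiftInsert f v X ∈ compressSub f v 𝓐 S) Y ∧ shiftInsert f v Y = X) := by
  simp only [← forced_iff hf hv hS hI]
  constructor
  · intro h
    by_cases hX : Forced f v (unshifted f v 𝓐) (· ∈ S) X
    · exact Or.inl hX
    · refine Or.inr ⟨mem_compressSub.2 (Or.inr ⟨h, hX⟩), ?_⟩
      rintro ⟨Y, hY, rfl⟩
      exact hY.shiftInsert_notMem hf hS hI h
  · rintro (h | ⟨h, h'⟩)
    · exact h.mem
    · obtain h | h := mem_compressSub.1 h
      · exact absurd h h'
      · exact h.1

end Compression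

lemma mem_interFams {s : ℕ} {𝓐 S : Finset (Finset ℕ)} :
    S ∈ interFams s 𝓐 ↔ S ⊆ 𝓐 ∧ S.card = s ∧ ∀ B ∈ S, ∀ B' ∈ S, (B ∩ B').Nonempty := by
  simp [interFams, mem_powersetCard, and_assoc]

section Counting

variable {f : ℕ → ℕ} {v : ℕ}

lemma image_compressSub_subset (hf : Function.Involutive f) (hv : f v = v) (s : ℕ)
    (𝓐 : Finset (Finset ℕ)) :
    (interFams s 𝓐).image (compressSub f v 𝓐) ⊆ interFams s (compress f v 𝓐) := by
  intro S' h
  obtain ⟨S, hS, rfl⟩ := mem_image.1 h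
  obtain ⟨h1, h2, h3⟩ := mem_interFams.1 hS
  exact mem_interFams.2 ⟨compressSub_subset h1, (card_compressSub hf hv h1 h3).trans h2,
    intersecting_compressSub h3⟩

lemma card_image_compressSub (hf : Function.Involutive f) (hv : f v = v) (s : ℕ)
    (𝓐 : Finset (Finset ℕ)) :
    ((interFams s 𝓐).image (compressSub f v 𝓐)).card = (interFams s 𝓐).card := by
  apply card_image_of_injOn
  intro S hS S' hS' h
  obtain ⟨h1, -, h3⟩ := mem_interFams.1 hS
  obtain ⟨h1', -, h3'⟩ := mem_interFams.1 hS'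
  ext X
  rw [mem_iff_of_compressSub hf hv h1 h3, mem_iff_of_compressSub hf hv h1' h3', h]

lemma card_interFams_le_compress (hf : Function.Involutive f) (hv : f v = v) (s : ℕ)
    (𝓐 : Finset (Finset ℕ)) :
    (interFams s 𝓐).card ≤ (interFams s (compress f v 𝓐)).card := by
  rw [← card_image_compressSub hf hv s 𝓐]
  exact card_le_card (image_compressSub_subset hf hv s 𝓐)

lemma card_interFams_lt_compress (hf : Function.Involutive f) (hv : f v = v) {s : ℕ}
    {𝓐 S' : Finset (Finset ℕ)} (hS' : S' ∈ interFams s (compress f v 𝓐)) {X Z : Finset ℕ}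
    (hX : X ∈ unshifted f v 𝓐) (hXS : shiftInsert f v X ∈ S') (hZ : Z ∈ S')
    (hd : Disjoint X Z) (hor : v ∉ Z ∨ X.image f = X) :
    (interFams s 𝓐).card < (interFams s (compress f v 𝓐)).card := by
  rw [← card_image_compressSub hf hv s 𝓐]
  refine card_lt_card ⟨image_compressSub_subset hf hv s 𝓐, fun h => ?_⟩
  obtain ⟨S, hS, rfl⟩ := mem_image.1 (h hS')
  obtain ⟨h1, -, h3⟩ := mem_interFams.1 hS
  have hXm : X ∈ S := (mem_iff_of_compressSub hf hv h1 h3).2 (Or.inl (Forced.base hX hXS))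
  have hne : ∀ Y ∈ S, ¬ Disjoint X Y := fun Y hY =>
    not_disjoint_iff_nonempty_inter.2 (h3 _ hXm _ hY)
  obtain ⟨Y, hY, rfl⟩ | ⟨hZ, -⟩ := mem_compressSub.1 hZ
  · have hXX := hor.resolve_left (fun h => h (mem_shiftInsert_self Y))
    refine hne Y hY.mem ?_
    rw [← hXX, disjoint_image_comm hf]
    exact hd.mono_right (subset_insert _ _)
  · exact hne Z hZ hd

end Counting

/-- Two disjoint finsets of equal size are exchanged by an involution fixing everything else. -/
lemma exists_involutive_image_eq {α : Type*} [DecidableEq α] {U V : Finset α} (hUV : Disjoint U V)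
    (hc : U.card = V.card) :
    ∃ f : α → α, Function.Involutive f ∧ U.image f = V ∧ V.image f = U ∧
      ∀ x, x ∉ U → x ∉ V → f x = x := by
  let e : U ≃ V := Finset.equivOfCardEq hc
  let f : α → α := fun x =>
    if h : x ∈ U then e ⟨x, h⟩ else if h : x ∈ V then e.symm ⟨x, h⟩ else x
  have hU : ∀ x (h : x ∈ U), f x = e ⟨x, h⟩ := fun x h => dif_pos h
  have hV : ∀ x (h : x ∈ V), f x = e.symm ⟨x, h⟩ := fun x h => by
    simp only [f]
    rw [dif_neg (disjoint_right.1 hUV h), dif_pos h]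
  have hUm : ∀ x ∈ U, f x ∈ V := fun x h => by rw [hU x h]; exact (e _).2
  have hVm : ∀ x ∈ V, f x ∈ U := fun x h => by rw [hV x h]; exact (e.symm _).2
  have ho : ∀ x, x ∉ U → x ∉ V → f x = x := fun x h h' => by
    simp only [f]
    rw [dif_neg h, dif_neg h']
  have hf : Function.Involutive f := by
    intro x
    by_cases h : x ∈ U
    · rw [hV _ (hUm x h)]
      simp [hU x h]
    by_cases h' : x ∈ V
    · rw [hU _ (hVm x h')]
      simp [hV x h']
    · rw [ho x h h', ho x h h']
  refine ⟨f, hf, ?_, ?_, ho⟩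
  · exact Subset.antisymm (image_subset_iff.2 hUm)
      fun x h => mem_image.2 ⟨f x, hVm x h, hf x⟩
  · exact Subset.antisymm (image_subset_iff.2 hVm)
      fun x h => mem_image.2 ⟨f x, hUm x h, hf x⟩

lemma exists_shiftInsert_eq {α : Type*} [DecidableEq α] {G X Y : Finset α} (hX : X ⊆ G)
    (hY : Y ⊆ G) (hc : Y.card = X.card + 1) :
    ∃ (f : α → α) (v : α), Function.Involutive f ∧ f v = v ∧ v ∈ G ∧ (∀ x ∈ G, f x ∈ G) ∧
      v ∉ X ∧ shiftInsert f v X = Y := by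
  obtain ⟨v, hvY, hvX⟩ : ∃ v ∈ Y, v ∉ X := by
    by_contra! h
    have := card_le_card h
    omega
  have hcard : (X \ Y.erase v).card = (Y.erase v \ X).card := by
    apply card_sdiff_comm
    rw [card_erase_of_mem hvY]
    omega
  obtain ⟨f, hf, hU, hV, ho⟩ := exists_involutive_image_eq
    (disjoint_left.2 fun x hx hx' => (mem_sdiff.1 hx').2 (mem_sdiff.1 hx).1) hcard
  refine ⟨f, v, hf, ho v (by simp [hvX]) (by simp), hY hvY, fun x hx => ?_, hvX, ?_⟩
  · by_cases h : x ∈ X \ Y.erase v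
    · have := hU ▸ mem_image_of_mem f h
      exact hY (mem_of_mem_erase (mem_sdiff.1 this).1)
    by_cases h' : x ∈ Y.erase v \ X
    · have := hV ▸ mem_image_of_mem f h'
      exact hX (mem_sdiff.1 this).1
    · rwa [ho x h h']
  · have hfix : (X ∩ Y.erase v).image f = X ∩ Y.erase v := by
      conv_rhs => rw [← image_id (s := X ∩ Y.erase v)]
      refine image_congr fun x hx => ho x ?_ ?_ <;>
        simp only [coe_inter, Set.mem_inter_iff, mem_coe] at hx <;> simp only [mem_sdiff] <;> tauto
    have : X.image f = Y.erase v := by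
      conv_lhs => rw [← sdiff_union_inter X (Y.erase v)]
      rw [image_union, hU, hfix, inter_comm, sdiff_union_inter]
    rw [shiftInsert, this, insert_erase hvY]

lemma mem_layerGE {n r : ℕ} {A : Finset ℕ} : A ∈ layerGE n r ↔ A ⊆ groundSet n ∧ r ≤ A.card := by
  simp [layerGE, allFams]

lemma card_layerGE (n r : ℕ) : (layerGE n r).card = ∑ k ∈ Finset.Icc r n, n.choose k := by
  have hG : (groundSet n).card = n := by simp [groundSet]
  rw [card_eq_sum_card_fiberwise (f := Finset.card) (t := Finset.Icc r n)]
  · refine sum_congr rfl fun k hk => ?_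
    rw [show #{A ∈ layerGE n r | A.card = k} = #((groundSet n).powersetCard k) from ?_,
      card_powersetCard, hG]
    congr 1
    ext A
    simp only [mem_filter, mem_layerGE, mem_powersetCard]
    have := (mem_Icc.1 hk).1
    exact ⟨fun h => ⟨h.1.1, h.2⟩, fun h => ⟨⟨h.1, by omega⟩, h.2⟩⟩
  · intro A hA
    obtain ⟨h1, h2⟩ := mem_layerGE.1 hA
    have := card_le_card h1
    simp only [coe_Icc, Set.mem_Icc]
    omega

lemma compress_subset_powerset {f : ℕ → ℕ} {v : ℕ} {G : Finset ℕ} (hv : v ∈ G)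
    (hG : ∀ x ∈ G, f x ∈ G) {𝓐 : Finset (Finset ℕ)} (h : 𝓐 ⊆ G.powerset) :
    compress f v 𝓐 ⊆ G.powerset := by
  refine union_subset (sdiff_subset.trans h) fun Y hY => ?_
  obtain ⟨X, hX, rfl⟩ := mem_image.1 hY
  have hXG := mem_powerset.1 (h (unshifted_subset 𝓐 hX))
  rw [mem_powerset, shiftInsert, insert_subset_iff, image_subset_iff]
  exact ⟨hv, fun x hx => hG x (hXG hx)⟩

/-- If a set larger than some member of `𝓐` is missing from `𝓐`, then so is a set with exactly one
more element than some member. -/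
lemma exists_notMem_card_succ {G : Finset ℕ} {𝓐 : Finset (Finset ℕ)} {B A : Finset ℕ}
    (hB : B ∈ 𝓐) (hA : A ⊆ G) (hAm : A ∉ 𝓐) (hBA : B.card < A.card) :
    ∃ X ∈ 𝓐, ∃ Y ⊆ G, Y ∉ 𝓐 ∧ Y.card = X.card + 1 := by
  by_contra! hcon
  have key : ∀ d, ∀ Y ⊆ G, Y.card = B.card + 1 + d → Y ∈ 𝓐 := by
    intro d
    induction d with
    | zero =>
      intro Y hY hc
      by_contra h
      exact hcon B hB Y hY h hc
    | succ d ih =>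
      intro Y hY hc
      by_contra h
      obtain ⟨X, hXY, hX⟩ := exists_subset_card_eq (s := Y) (n := B.card + 1 + d) (by omega)
      exact hcon X (ih X (hXY.trans hY) hX) Y hY h (by omega)
  exact hAm (key (A.card - B.card - 1) A hA (by omega))

/-- Two intersecting sets, one of size at least `r` and one of size more than half of the ground
set, lie in a maximal intersecting family of sets of size at least `r`. -/
lemma exists_maximal_intersecting {ι : Type*} [Fintype ι] [DecidableEq ι] {r : ℕ}
    (hr : 2 * r < Fintype.card ι) {A Z : Finset ι} (hAr : r ≤ A.card)
    (hZn : Fintype.card ι < 2 * Z.card) (hAZ : (A ∩ Z).Nonempty) :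
    ∃ t : Finset (Finset ι), A ∈ t ∧ Z ∈ t ∧ 2 * t.card = 2 ^ Fintype.card ι ∧
      (∀ B ∈ t, ∀ B' ∈ t, (B ∩ B').Nonempty) ∧ ∀ B ∈ t, r ≤ B.card := by
  let t₀ : Finset (Finset ι) :=
    insert A (univ.filter fun Y => Fintype.card ι < 2 * Y.card ∧ ¬ Disjoint A Y)
  have hmem : ∀ Y, Y ∈ t₀ ↔ Y = A ∨ (Fintype.card ι < 2 * Y.card ∧ ¬ Disjoint A Y) := by
    simp [t₀]
  have hA : ¬ Disjoint A A := by
    rw [disjoint_self_iff_empty]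
    rintro rfl
    simp at hAZ
  have ht₀ : (t₀ : Set (Finset ι)).Intersecting := by
    intro Y hY Y' hY'
    rw [mem_coe, hmem] at hY hY'
    obtain rfl | ⟨hc, hY⟩ := hY <;> obtain rfl | ⟨hc', hY'⟩ := hY'
    · exact hA
    · exact hY'
    · exact fun h => hY h.symm
    · intro h
      have := card_le_univ (Y ∪ Y')
      rw [card_union_of_disjoint h] at this
      omega
  have : Nonempty ι := hAZ.to_type
  obtain ⟨t, htt, hcard, ht⟩ := ht₀.exists_card_eq
  refine ⟨t, htt ((hmem A).2 (Or.inl rfl)),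
    htt ((hmem Z).2 (Or.inr ⟨hZn, not_disjoint_iff_nonempty_inter.2 hAZ⟩)),
    hcard.trans Fintype.card_finset,
    fun B hB B' hB' => not_disjoint_iff_nonempty_inter.1 (ht hB hB'), fun B hB => ?_⟩
  by_contra! h
  have hBc : Bᶜ ∉ t₀ := fun h' => ht hB (htt h') disjoint_compl_right
  rw [hmem, card_compl] at hBc
  push Not at hBc
  have hAB := card_le_card (_root_.disjoint_compl_right_iff.1 (hBc.2 (by omega)))
  omega

/-- Two intersecting sets, one of size at least `r` and one of size more than `n / 2`, lie in an
intersecting family of sets of size at least `r` of any admissible size. -/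
lemma exists_interFams_layerGE {n r s : ℕ} (hs1 : 2 ≤ s) (hs2 : s ≤ 2 ^ (n - 1)) (hn : 2 * r < n)
    {A Z : Finset ℕ} (hA : A ⊆ groundSet n) (hZ : Z ⊆ groundSet n) (hAr : r ≤ A.card)
    (hZn : n < 2 * Z.card) (hAZ : (A ∩ Z).Nonempty) :
    ∃ S ∈ interFams s (layerGE n r), A ∈ S ∧ Z ∈ S := by
  let φ : Finset (groundSet n) → Finset ℕ := Finset.map (Function.Embedding.subtype _)
  have hφ : Function.Injective φ := map_injective _
  have hc : Fintype.card (groundSet n) = n := by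
    rw [Fintype.card_coe, groundSet, Nat.card_Icc, Nat.add_sub_cancel]
  have hlift : ∀ Y ⊆ groundSet n, ∃ Y', φ Y' = Y := fun Y hY =>
    ⟨Y.subtype (· ∈ groundSet n), subtype_map_of_mem hY⟩
  obtain ⟨A, rfl⟩ := hlift A hA
  obtain ⟨Z, rfl⟩ := hlift Z hZ
  rw [card_map] at hAr hZn
  rw [← map_inter, map_nonempty] at hAZ
  obtain ⟨t, hAt, hZt, ht, hI, htr⟩ :=
    exists_maximal_intersecting (r := r) (by omega) hAr (by omega) hAZ
  have htc : t.card = 2 ^ (n - 1) := by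
    obtain ⟨m, rfl⟩ : ∃ m, n = m + 1 := ⟨n - 1, by omega⟩
    rw [hc, pow_succ] at ht
    rw [Nat.add_sub_cancel]
    omega
  obtain ⟨S, hS, hSt, hSc⟩ := exists_subsuperset_card_eq (s := {A, Z}) (t := t) (n := s)
    (by simp [insert_subset_iff, hAt, hZt]) (card_le_two.trans hs1) (hs2.trans_eq htc.symm)
  refine ⟨S.image φ, mem_interFams.2 ⟨?_, (card_image_of_injective S hφ).trans hSc, ?_⟩,
    mem_image_of_mem φ (hS (by simp)), mem_image_of_mem φ (hS (by simp))⟩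
  · refine image_subset_iff.2 fun Y hY => mem_layerGE.2 ⟨map_subtype_subset Y, ?_⟩
    rw [card_map]
    exact htr Y (hSt hY)
  · simp only [forall_mem_image]
    intro Y hY Y' hY'
    rw [← map_inter, map_nonempty]
    exact hI Y (hSt hY) Y' (hSt hY')

lemma exists_card_interFams_lt {n s r : ℕ} (hs1 : 2 ≤ s) (hs2 : s ≤ 2 ^ (n - 1))
    (hr : 2 * r + 3 ≤ n) (𝓐 : Finset (Finset ℕ)) (h𝓐 : 𝓐 ⊆ allFams n)
    (hcard : (layerGE n (r + 1)).card ≤ 𝓐.card) (hnsub : ¬layerGE n (r + 1) ⊆ 𝓐) :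
    ∃ 𝓐' ⊆ allFams n, 𝓐'.card = 𝓐.card ∧ (interFams s 𝓐).card < (interFams s 𝓐').card := by
  induction hm : 𝓐.card * n - ∑ X ∈ 𝓐, X.card using Nat.strong_induction_on generalizing 𝓐 with
  | _ m ih =>
  obtain ⟨B, hB, hBr⟩ : ∃ B ∈ 𝓐, B.card ≤ r := by
    by_contra! h
    have hsub : 𝓐 ⊆ layerGE n (r + 1) := fun X hX =>
      mem_layerGE.2 ⟨mem_powerset.1 (h𝓐 hX), h X hX⟩
    exact hnsub (eq_of_subset_of_card_le hsub hcard).ge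
  obtain ⟨A, hA, hAm⟩ := not_subset.1 hnsub
  obtain ⟨hAG, hAr⟩ := mem_layerGE.1 hA
  obtain ⟨X, hX, Y, hYG, hY, hYX⟩ := exists_notMem_card_succ hB hAG hAm (by omega)
  obtain ⟨f, v, hf, hv, hvG, hG, hvX, rfl⟩ :=
    exists_shiftInsert_eq (mem_powerset.1 (h𝓐 hX)) hYG hYX
  have hXu : X ∈ unshifted f v 𝓐 := mem_unshifted.2 ⟨hX, hvX, hY⟩
  have hsub := compress_subset_powerset hvG hG h𝓐
  have hcc := card_compress hf hv 𝓐
  by_cases hlayer : layerGE n (r + 1) ⊆ compress f v 𝓐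
  · refine ⟨compress f v 𝓐, hsub, hcc, ?_⟩
    clear hXu hvX hX hYG hY hYX X
    have hA' := hlayer hA
    rw [compress, mem_union, mem_sdiff, mem_image] at hA'
    obtain ⟨X, hXu, rfl⟩ := hA'.resolve_left fun h => hAm h.1
    obtain ⟨hX, hvX, -⟩ := mem_unshifted.1 hXu
    have hXG : X ⊆ groundSet n := mem_powerset.1 (h𝓐 hX)
    have hXc : X.card < r + 1 := by
      by_contra! h
      have := hlayer (mem_layerGE.2 ⟨hXG, h⟩)
      rw [compress, mem_union, mem_sdiff, mem_image] at this
      obtain h | ⟨Y, -, rfl⟩ := this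
      · exact h.2 hXu
      · exact hvX (mem_shiftInsert_self Y)
    have hGc : (groundSet n).card = n := by simp [groundSet]
    obtain ⟨Z, hZG, hZn, hAZ, hd, hor⟩ : ∃ Z ⊆ groundSet n, n < 2 * Z.card ∧
        (shiftInsert f v X ∩ Z).Nonempty ∧ Disjoint X Z ∧ (v ∉ Z ∨ X.image f = X) := by
      by_cases hXX : X.image f = X
      · refine ⟨groundSet n \ X, sdiff_subset, ?_, ?_, disjoint_sdiff, Or.inr hXX⟩
        · rw [card_sdiff_of_subset hXG]
          omega
        · exact ⟨v, mem_inter.2 ⟨mem_shiftInsert_self X, mem_sdiff.2 ⟨hvG, hvX⟩⟩⟩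
      · refine ⟨groundSet n \ insert v X, sdiff_subset, ?_, ?_, ?_, Or.inl (by simp)⟩
        · rw [card_sdiff_of_subset (insert_subset hvG hXG), card_insert_of_notMem hvX]
          omega
        · obtain ⟨y, hy, hyX⟩ : ∃ y ∈ X.image f, y ∉ X := by
            by_contra! h
            exact hXX (eq_of_subset_of_card_le h (card_image_of_injective X hf.injective).ge)
          have hyA : y ∈ (shiftInsert f v X).erase v := by rwa [shiftInsert_erase hf hv hvX]
          obtain ⟨hyv, hyA⟩ := mem_erase.1 hyA
          exact ⟨y, mem_inter.2 ⟨hyA, mem_sdiff.2 ⟨hAG hyA, by simp [hyv, hyX]⟩⟩⟩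
        · exact disjoint_sdiff.mono_left (subset_insert _ _)
    obtain ⟨S, hS, hAS, hZS⟩ := exists_interFams_layerGE hs1 hs2 (by omega) hAG hZG hAr hZn hAZ
    obtain ⟨h1, h2, h3⟩ := mem_interFams.1 hS
    exact card_interFams_lt_compress hf hv (mem_interFams.2 ⟨h1.trans hlayer, h2, h3⟩) hXu hAS hZS
      hd hor
  · have hsum : ∑ X ∈ compress f v 𝓐, X.card ≤ 𝓐.card * n := by
      rw [← hcc]
      refine sum_le_card_nsmul _ _ n fun X hX => ?_
      have := card_le_card (mem_powerset.1 (hsub hX))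
      simpa [groundSet] using this
    have hsum' := sum_card_compress hf hv 𝓐
    have hpos := card_pos.2 ⟨X, hXu⟩
    obtain ⟨𝓐', h1, h2, h3⟩ := ih _ (by rw [← hm, hcc]; omega) (compress f v 𝓐) hsub
      (by rwa [hcc]) hlayer rfl
    exact ⟨𝓐', h1, h2.trans hcc, (card_interFams_le_compress hf hv s 𝓐).trans_lt h3⟩

theorem stmt9 (n N s r : ℕ) (hn : 1 ≤ n) (hN0 : 1 ≤ N) (hN : N ≤ 2 ^ n)
    (hs1 : 2 ≤ s) (hs2 : s ≤ 2 ^ (n - 1))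
    (hr1 : ∑ k ∈ Finset.Icc (r + 1) n, n.choose k ≤ N)
    (hr2 : N < ∑ k ∈ Finset.Icc r n, n.choose k)
    (hr : (r : ℝ) < (n : ℝ) / 2 - 1)
    (𝓐 : Finset (Finset ℕ)) (h𝓐 : 𝓐 ⊆ allFams n) (hcard : 𝓐.card = N)
    (hnsub : ¬layerGE n (r + 1) ⊆ 𝓐) :
    ∃ 𝓐' ⊆ allFams n, 𝓐'.card = N ∧
      (interFams s 𝓐).card < (interFams s 𝓐').card := by
  subst hcard
  refine exists_card_interFams_lt hs1 hs2 ?_ 𝓐 h𝓐 ((card_layerGE n (r + 1)).trans_le hr1) hnsub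
  have : (2 * r + 2 : ℝ) < n := by linarith
  exact_mod_cast this
end

section
/- Let n ≥ 21, let s be a positive integer, and let r be an integer with 4 ≤ r ≤ n−1. For 0 ≤ j ≤ n−1 let 𝕀_j denote the collection of intersecting families 𝓔 ⊆ [n]^(≥2) with |𝓔| = s and 𝓔 ∩ [n]^(2) = 𝒮_j, where 𝒮_j = {{1,t} : 2 ≤ t ≤ j+1}. Then 2·|𝕀_{r−1}| ≥ (2^(n−r−1) − (n−r))·|𝕀_r|. -/
open Finset

/-- The collection of intersecting families `𝓔 ⊆ [n]^(≥2)` with `|𝓔| = s` and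
`𝓔 ∩ [n]^(2) = T`. -/
def interLayerFams (n s : ℕ) (T : Finset (Finset ℕ)) : Finset (Finset (Finset ℕ)) :=
  ((layerGE n 2).powersetCard s).filter fun 𝓔 =>
    (∀ B ∈ 𝓔, ∀ B' ∈ 𝓔, (B ∩ B').Nonempty) ∧ 𝓔 ∩ layerEQ n 2 = T

/-- The star `𝒮_j = {{1, t} : 2 ≤ t ≤ j + 1}`. -/
def star (j : ℕ) : Finset (Finset ℕ) := (Finset.Icc 2 (j + 1)).image fun t => {1, t}

/-- The antichains of subsets of `M` of size at least two. -/
def bigAntichains (M : Finset ℕ) : Finset (Finset (Finset ℕ)) :=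
  (M.powerset.filter fun A => 2 ≤ A.card).powerset.filter fun 𝓐 =>
    ∀ a ∈ 𝓐, ∀ b ∈ 𝓐, a ⊆ b → a = b

lemma mem_bigAntichains {M : Finset ℕ} {𝓐 : Finset (Finset ℕ)} :
    𝓐 ∈ bigAntichains M ↔
      (∀ a ∈ 𝓐, a ⊆ M ∧ 2 ≤ a.card) ∧ ∀ a ∈ 𝓐, ∀ b ∈ 𝓐, a ⊆ b → a = b := by
  simp [bigAntichains, subset_iff (s₁ := 𝓐)]

lemma card_powerset_filter_two_le (M : Finset ℕ) :
    (M.powerset.filter fun A => 2 ≤ A.card).card = 2 ^ M.card - (M.card + 1) := by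
  have h := card_filter_add_card_filter_not (s := M.powerset) (fun A => 2 ≤ A.card)
  have h2 : (M.powerset.filter fun A => ¬ 2 ≤ A.card) = insert ∅ (M.powersetCard 1) := by
    ext A
    simp only [mem_filter, mem_powerset, mem_insert, mem_powersetCard]
    rw [← card_eq_zero]
    constructor
    · rintro ⟨h1, h2⟩
      by_cases h : A.card = 0
      · exact Or.inl h
      · exact Or.inr ⟨h1, by omega⟩
    · rintro (h | ⟨h1, h2⟩)
      · rw [card_eq_zero] at h
        subst h
        simp
      · exact ⟨h1, by omega⟩
  rw [h2, card_insert_of_notMem (by simp), card_powersetCard, card_powerset, Nat.choose_one_right]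
    at h
  omega

/-- The number of `a`-subsets of `U` containing `𝓐` is monotone in the stated sense. -/
lemma card_superset_le {α : Type*} [DecidableEq α] {U U' 𝓐 𝓐' : Finset α} {a : ℕ}
    (hU : U'.card = U.card + 1) (h : 𝓐 ⊆ U) (h' : 𝓐' ⊆ U') (hc : 𝓐'.card ≤ 𝓐.card + 1) :
    ((U.powersetCard a).filter fun T => 𝓐 ⊆ T).card ≤
      ((U'.powersetCard (a + 1)).filter fun T => 𝓐' ⊆ T).card := by
  have key : ∀ (V 𝓑 : Finset α) (k : ℕ), 𝓑 ⊆ V →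
      ((V.powersetCard (k + 𝓑.card)).filter fun T => 𝓑 ⊆ T).card =
        (V.card - 𝓑.card).choose k := by
    intro V 𝓑 k hV
    rw [← card_sdiff_of_subset hV, ← card_powersetCard]
    symm
    refine card_bij (fun S _ => S ∪ 𝓑) ?_ ?_ ?_
    · intro S hS
      simp only [mem_powersetCard, mem_filter] at hS ⊢
      have hd : Disjoint S 𝓑 := disjoint_of_subset_left hS.1 sdiff_disjoint
      exact ⟨⟨union_subset (hS.1.trans sdiff_subset) hV, by rw [card_union_of_disjoint hd, hS.2]⟩,
        subset_union_right⟩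
    · intro S hS S' hS' heq
      simp only [mem_powersetCard] at hS hS'
      have hd : Disjoint S 𝓑 := disjoint_of_subset_left hS.1 sdiff_disjoint
      have hd' : Disjoint S' 𝓑 := disjoint_of_subset_left hS'.1 sdiff_disjoint
      rw [← union_sdiff_cancel_right hd, heq, union_sdiff_cancel_right hd']
    · intro T hT
      simp only [mem_powersetCard, mem_filter] at hT
      refine ⟨T \ 𝓑, ?_, sdiff_union_of_subset hT.2⟩
      rw [mem_powersetCard, card_sdiff_of_subset hT.2]
      exact ⟨sdiff_subset_sdiff hT.1.1 le_rfl, by omega⟩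
  rcases lt_or_ge a 𝓐.card with hlt | hge
  · rw [filter_false_of_mem]
    · simp
    · intro T hT hAT
      have := card_le_card hAT
      rw [mem_powersetCard] at hT
      omega
  · obtain ⟨k, rfl⟩ := Nat.exists_eq_add_of_le' hge
    obtain ⟨d, hd⟩ := Nat.exists_eq_add_of_le' hc
    have e : k + 𝓐.card + 1 = (k + d) + 𝓐'.card := by omega
    have hAU := card_le_card h
    rw [e, key U 𝓐 k h, key U' 𝓐' (k + d) h']
    have e2 : U'.card - 𝓐'.card = (U.card - 𝓐.card) + d := by omega
    rw [e2]
    clear hd e e2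
    induction d with
    | zero => exact le_rfl
    | succ d ih => exact ih.trans (by
      rw [← add_assoc, ← add_assoc, Nat.choose_succ_succ]
      exact Nat.le_add_right _ _)

/-- If `X` contains a member of `𝓐`, adjoin the new point `v` to the members of `𝓐` below `X`
and add `X` itself unless it already belongs to `𝓐`. -/
def liftBelow (v : ℕ) (𝓐 : Finset (Finset ℕ)) (X : Finset ℕ) : Finset (Finset ℕ) :=
  ((𝓐.filter fun a => a ⊆ X).image (insert v)) ∪ (𝓐.filter fun a => ¬ a ⊆ X) ∪
    (if X ∈ 𝓐 then ∅ else {X})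

lemma mem_liftBelow {v : ℕ} {𝓐 : Finset (Finset ℕ)} {X b : Finset ℕ} :
    b ∈ liftBelow v 𝓐 X ↔
      (∃ a ∈ 𝓐, a ⊆ X ∧ insert v a = b) ∨ (b ∈ 𝓐 ∧ ¬ b ⊆ X) ∨ (b = X ∧ X ∉ 𝓐) := by
  unfold liftBelow
  split_ifs with h <;> simp [h, and_assoc]
  grind

lemma card_liftBelow_le (v : ℕ) (𝓐 : Finset (Finset ℕ)) (X : Finset ℕ) :
    (liftBelow v 𝓐 X).card ≤ 𝓐.card + 1 := by
  unfold liftBelow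
  have h1 := card_filter_add_card_filter_not (s := 𝓐) (fun a => a ⊆ X)
  have h2 : (if X ∈ 𝓐 then (∅ : Finset (Finset ℕ)) else {X}).card ≤ 1 := by
    split_ifs <;> simp
  have h3 : ((𝓐.filter fun a => a ⊆ X).image (insert v)).card ≤ _ := card_image_le
  have h4 := card_union_le (((𝓐.filter fun a => a ⊆ X).image (insert v)) ∪
    (𝓐.filter fun a => ¬ a ⊆ X)) (if X ∈ 𝓐 then ∅ else {X})
  have h5 := card_union_le ((𝓐.filter fun a => a ⊆ X).image (insert v))
    (𝓐.filter fun a => ¬ a ⊆ X)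
  omega

lemma mem_iff_minimal_liftBelow {v : ℕ} {M : Finset ℕ} (hv : v ∉ M) {𝓐 : Finset (Finset ℕ)}
    {X : Finset ℕ} (hA : 𝓐 ∈ bigAntichains M) (hX : X ⊆ M) (h : ∃ a ∈ 𝓐, a ⊆ X) (c : Finset ℕ) :
    c ∈ 𝓐 ↔ (∃ b ∈ liftBelow v 𝓐 X, b.erase v = c) ∧
      ∀ b ∈ liftBelow v 𝓐 X, b.erase v ⊆ c → b.erase v = c := by
  rw [mem_bigAntichains] at hA
  obtain ⟨hM, hanti⟩ := hA
  obtain ⟨a₀, ha₀, ha₀X⟩ := h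
  have hvA : ∀ a ∈ 𝓐, v ∉ a := fun a ha hva => hv ((hM a ha).1 hva)
  have hvX : v ∉ X := fun h => hv (hX h)
  have hup : ∀ a ∈ 𝓐, ∃ b ∈ liftBelow v 𝓐 X, b.erase v = a := by
    intro a ha
    by_cases haX : a ⊆ X
    · exact ⟨insert v a, mem_liftBelow.2 (Or.inl ⟨a, ha, haX, rfl⟩), erase_insert (hvA a ha)⟩
    · exact ⟨a, mem_liftBelow.2 (Or.inr (Or.inl ⟨ha, haX⟩)), erase_eq_of_notMem (hvA a ha)⟩
  have hdown : ∀ b ∈ liftBelow v 𝓐 X, b.erase v ∈ 𝓐 ∨ (b.erase v = X ∧ X ∉ 𝓐) := by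
    intro b hb
    rcases mem_liftBelow.1 hb with ⟨a, ha, -, rfl⟩ | ⟨hb, -⟩ | ⟨rfl, hb⟩
    · left; rwa [erase_insert (hvA a ha)]
    · left; rwa [erase_eq_of_notMem (hvA b hb)]
    · right; exact ⟨erase_eq_of_notMem hvX, hb⟩
  constructor
  · intro hc
    refine ⟨hup c hc, fun b hb hbc => ?_⟩
    rcases hdown b hb with h | ⟨h, hXA⟩
    · exact hanti _ h _ hc hbc
    · rw [h] at hbc
      have := hanti _ ha₀ _ hc (ha₀X.trans hbc)
      subst this
      exact absurd (Subset.antisymm hbc ha₀X ▸ hc) hXA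
  · rintro ⟨⟨b, hb, rfl⟩, hmin⟩
    rcases hdown b hb with h | ⟨h, -⟩
    · exact h
    · obtain ⟨b', hb', he⟩ := hup a₀ ha₀
      rw [← hmin b' hb' (by rw [he, h]; exact ha₀X), he]
      exact ha₀

lemma liftBelow_mem_bigAntichains {v : ℕ} {M : Finset ℕ} (hv : v ∉ M) {𝓐 : Finset (Finset ℕ)}
    {X : Finset ℕ} (hA : 𝓐 ∈ bigAntichains M) (hX : X ⊆ M) (hX2 : 2 ≤ X.card)
    (h : ∃ a ∈ 𝓐, a ⊆ X) : liftBelow v 𝓐 X ∈ bigAntichains (insert v M) := by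
  rw [mem_bigAntichains] at hA ⊢
  obtain ⟨hM, hanti⟩ := hA
  obtain ⟨a₀, ha₀, ha₀X⟩ := h
  have hvA : ∀ a ∈ 𝓐, v ∉ a := fun a ha hva => hv ((hM a ha).1 hva)
  have hvX : v ∉ X := fun h => hv (hX h)
  constructor
  · intro b hb
    rcases mem_liftBelow.1 hb with ⟨a, ha, -, rfl⟩ | ⟨hb, -⟩ | ⟨rfl, hb⟩
    · exact ⟨insert_subset_insert _ (hM a ha).1,
        (hM a ha).2.trans (card_le_card (subset_insert _ _))⟩
    · exact ⟨(hM b hb).1.trans (subset_insert _ _), (hM b hb).2⟩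
    · exact ⟨hX.trans (subset_insert _ _), hX2⟩
  · intro b hb c hc hbc
    rcases mem_liftBelow.1 hb with ⟨a, ha, haX, rfl⟩ | ⟨hb, hbX⟩ | ⟨rfl, hb⟩ <;>
    rcases mem_liftBelow.1 hc with ⟨a', ha', haX', rfl⟩ | ⟨hc, hcX⟩ | ⟨rfl, hc⟩
    · rw [insert_subset_insert_iff (hvA a ha)] at hbc
      rw [hanti a ha a' ha' hbc]
    · exact absurd (hbc (mem_insert_self _ _)) (hvA c hc)
    · exact absurd (hbc (mem_insert_self _ _)) hvX
    · rw [subset_insert_iff_of_notMem (hvA b hb)] at hbc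
      exact absurd (hbc.trans haX') hbX
    · exact hanti b hb c hc hbc
    · exact absurd hbc hbX
    · rw [subset_insert_iff_of_notMem hvX] at hbc
      exact absurd (Subset.antisymm haX' hbc ▸ ha') hb
    · have := hanti _ ha₀ _ hc (ha₀X.trans hbc)
      subst this
      exact absurd ha₀X hcX
    · rfl

lemma liftBelow_injOn {v : ℕ} {M : Finset ℕ} (hv : v ∉ M) {𝓐 𝓑 : Finset (Finset ℕ)}
    {X Y : Finset ℕ} (hA : 𝓐 ∈ bigAntichains M) (hB : 𝓑 ∈ bigAntichains M) (hX : X ⊆ M)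
    (hY : Y ⊆ M) (h : ∃ a ∈ 𝓐, a ⊆ X) (h' : ∃ a ∈ 𝓑, a ⊆ Y)
    (he : liftBelow v 𝓐 X = liftBelow v 𝓑 Y) : 𝓐 = 𝓑 ∧ X = Y := by
  have hAB : 𝓐 = 𝓑 := by
    ext c
    rw [mem_iff_minimal_liftBelow hv hA hX h, mem_iff_minimal_liftBelow hv hB hY h', he]
  subst hAB
  refine ⟨rfl, ?_⟩
  rw [mem_bigAntichains] at hA
  obtain ⟨hM, hanti⟩ := hA
  have hvA : ∀ a ∈ 𝓐, v ∉ a := fun a ha hva => hv ((hM a ha).1 hva)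
  have new : ∀ {X Y : Finset ℕ}, X ⊆ M → liftBelow v 𝓐 X = liftBelow v 𝓐 Y → X ∉ 𝓐 → X = Y := by
    intro X Y hX he hXA
    have hm : X ∈ liftBelow v 𝓐 Y := he ▸ mem_liftBelow.2 (Or.inr (Or.inr ⟨rfl, hXA⟩))
    rcases mem_liftBelow.1 hm with ⟨a, ha, -, rfl⟩ | ⟨hb, -⟩ | ⟨rfl, hb⟩
    · exact absurd (hX (mem_insert_self _ _)) hv
    · exact absurd hb hXA
    · rfl
  by_cases hXA : X ∈ 𝓐
  · by_cases hYA : Y ∈ 𝓐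
    · have hm : insert v X ∈ liftBelow v 𝓐 Y :=
        he ▸ mem_liftBelow.2 (Or.inl ⟨X, hXA, Subset.rfl, rfl⟩)
      rcases mem_liftBelow.1 hm with ⟨a, ha, haY, hax⟩ | ⟨hb, -⟩ | ⟨hb, -⟩
      · have : a = X := by
          rw [← erase_insert (hvA a ha), hax, erase_insert (hvA X hXA)]
        subst this
        exact hanti _ hXA _ hYA haY
      · exact absurd (mem_insert_self _ _) (hvA _ hb)
      · exact absurd (hY (hb ▸ mem_insert_self _ _)) hv
    · exact (new hY he.symm hYA).symm
  · exact new hX he hXA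

/-- Comparison of weighted sums over antichains when the ground set grows by one point. -/
lemma card_mul_sum_bigAntichains_le {v : ℕ} {M : Finset ℕ} (hv : v ∉ M)
    (g g' : Finset (Finset ℕ) → ℕ)
    (hg : ∀ 𝓐 ∈ bigAntichains M, ∀ 𝓑 ∈ bigAntichains (insert v M),
      𝓑.card ≤ 𝓐.card + 1 → g 𝓐 ≤ g' 𝓑) :
    (M.powerset.filter fun A => 2 ≤ A.card).card * ∑ 𝓐 ∈ bigAntichains M, g 𝓐 ≤
      2 * ∑ 𝓑 ∈ bigAntichains (insert v M), g' 𝓑 := by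
  classical
  have bound : ∀ (S : Finset (Finset (Finset ℕ) × Finset ℕ))
      (φ : Finset (Finset ℕ) × Finset ℕ → Finset (Finset ℕ)),
      (∀ p ∈ S, p.1 ∈ bigAntichains M) →
      (∀ p ∈ S, φ p ∈ bigAntichains (insert v M)) → (∀ p ∈ S, (φ p).card ≤ p.1.card + 1) →
      (∀ p ∈ S, ∀ q ∈ S, φ p = φ q → p = q) →
      ∑ p ∈ S, g p.1 ≤ ∑ 𝓑 ∈ bigAntichains (insert v M), g' 𝓑 := by
    intro S φ h0 h1 h2 h3
    calc ∑ p ∈ S, g p.1 ≤ ∑ p ∈ S, g' (φ p) :=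
          sum_le_sum fun p hp => hg _ (h0 p hp) _ (h1 p hp) (h2 p hp)
      _ = ∑ 𝓑 ∈ S.image φ, g' 𝓑 := (sum_image (fun p hp q hq => h3 p hp q hq)).symm
      _ ≤ _ := sum_le_sum_of_subset (image_subset_iff.2 h1)
  set P := bigAntichains M ×ˢ (M.powerset.filter fun A => 2 ≤ A.card) with hP
  have hsum : (M.powerset.filter fun A => 2 ≤ A.card).card * ∑ 𝓐 ∈ bigAntichains M, g 𝓐 =
      ∑ p ∈ P, g p.1 := by
    rw [hP, sum_product]
    simp [mul_sum]
  rw [hsum, ← sum_filter_add_sum_filter_not P (fun p => ∃ a ∈ p.1, a ⊆ p.2), two_mul]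
  have memP : ∀ p, p ∈ P ↔ p.1 ∈ bigAntichains M ∧ p.2 ⊆ M ∧ 2 ≤ p.2.card := by
    intro p
    simp [hP, mem_product]
  refine add_le_add (bound _ (fun p => liftBelow v p.1 p.2) ?_ ?_ ?_ ?_)
    (bound _ (fun p => insert (insert v p.2) p.1) ?_ ?_ ?_ ?_)
  · intro p hp
    rw [mem_filter, memP] at hp
    exact hp.1.1
  · intro p hp
    rw [mem_filter, memP] at hp
    exact liftBelow_mem_bigAntichains hv hp.1.1 hp.1.2.1 hp.1.2.2 hp.2
  · exact fun p _ => card_liftBelow_le _ _ _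
  · intro p hp q hq he
    rw [mem_filter, memP] at hp hq
    exact Prod.ext_iff.2 (liftBelow_injOn hv hp.1.1 hq.1.1 hp.1.2.1 hq.1.2.1 hp.2 hq.2 he)
  · intro p hp
    rw [mem_filter, memP] at hp
    exact hp.1.1
  · rintro ⟨𝓐, X⟩ hp
    rw [mem_filter, memP] at hp
    obtain ⟨⟨hA, hX, hX2⟩, hno⟩ := hp
    dsimp only at *
    rw [mem_bigAntichains] at hA ⊢
    obtain ⟨hM, hanti⟩ := hA
    have hvA : ∀ a ∈ 𝓐, v ∉ a := fun a ha hva => hv ((hM a ha).1 hva)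
    push Not at hno
    constructor
    · intro b hb
      rcases mem_insert.1 hb with rfl | hb
      · exact ⟨insert_subset_insert _ hX, hX2.trans (card_le_card (subset_insert _ _))⟩
      · exact ⟨(hM b hb).1.trans (subset_insert _ _), (hM b hb).2⟩
    · intro b hb c hc hbc
      rcases mem_insert.1 hb with rfl | hb <;> rcases mem_insert.1 hc with rfl | hc
      · rfl
      · exact absurd (hbc (mem_insert_self _ _)) (hvA c hc)
      · rw [subset_insert_iff_of_notMem (hvA b hb)] at hbc
        exact absurd hbc (hno b hb)
      · exact hanti b hb c hc hbc
  · exact fun p _ => card_insert_le _ _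
  · rintro ⟨𝓐, X⟩ hp ⟨𝓑, Y⟩ hq he
    rw [mem_filter, memP] at hp hq
    dsimp only at *
    have hvA : ∀ a ∈ 𝓐, v ∉ a := fun a ha hva => hv (((mem_bigAntichains.1 hp.1.1).1 a ha).1 hva)
    have hvB : ∀ a ∈ 𝓑, v ∉ a := fun a ha hva => hv (((mem_bigAntichains.1 hq.1.1).1 a ha).1 hva)
    have hXv : insert v X ∈ insert (insert v Y) 𝓑 := he ▸ mem_insert_self _ _
    have hXY : insert v X = insert v Y := by
      rcases mem_insert.1 hXv with h | h
      · exact h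
      · exact absurd (mem_insert_self _ _) (hvB _ h)
    have hA : insert v X ∉ 𝓐 := fun h => hvA _ h (mem_insert_self _ _)
    have hB : insert v Y ∉ 𝓑 := fun h => hvB _ h (mem_insert_self _ _)
    refine Prod.ext_iff.2 ⟨?_, ?_⟩
    · change 𝓐 = 𝓑
      rw [← erase_insert hA, he, hXY, erase_insert hB]
    · change X = Y
      rw [← erase_insert (fun h => hv (hp.1.2.1 h)), hXY, erase_insert (fun h => hv (hq.1.2.1 h))]

/-- The sets `Z ⊆ {2, …, n}` that encode the members of size at least three of an intersecting
family whose pairs are `star j`. -/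
def codeSets (n j : ℕ) : Finset (Finset ℕ) :=
  (Icc 2 n).powerset.filter fun Z => 2 ≤ Z.card ∨ Z ⊆ Icc (j + 2) n

lemma mem_codeSets {n j : ℕ} {Z : Finset ℕ} :
    Z ∈ codeSets n j ↔ Z ⊆ Icc 2 n ∧ (2 ≤ Z.card ∨ Z ⊆ Icc (j + 2) n) := by
  simp [codeSets]

/-- `Z` has at most one element or lies below a member of `𝓐`. -/
def IsLow (𝓐 : Finset (Finset ℕ)) (Z : Finset ℕ) : Prop := Z.card ≤ 1 ∨ ∃ a ∈ 𝓐, Z ⊆ a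

open scoped Classical in
/-- Low sets encode their complement in `{2, …, n}`, the others encode their union with `{1}`. -/
noncomputable def decodeSet (n : ℕ) (𝓐 : Finset (Finset ℕ)) (Z : Finset ℕ) : Finset ℕ :=
  if IsLow 𝓐 Z then Icc 2 n \ Z else insert 1 Z

/-- The intersecting family encoded by `𝓐` and `T`. -/
noncomputable def decodeFam (n j : ℕ) (𝓐 T : Finset (Finset ℕ)) : Finset (Finset ℕ) :=
  star j ∪ T.image (decodeSet n 𝓐)

lemma decodeSet_of_isLow {n : ℕ} {𝓐 : Finset (Finset ℕ)} {Z : Finset ℕ} (h : IsLow 𝓐 Z) :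
    decodeSet n 𝓐 Z = Icc 2 n \ Z := if_pos h

lemma decodeSet_of_not_isLow {n : ℕ} {𝓐 : Finset (Finset ℕ)} {Z : Finset ℕ} (h : ¬ IsLow 𝓐 Z) :
    decodeSet n 𝓐 Z = insert 1 Z := if_neg h

lemma one_mem_decodeSet {n : ℕ} {𝓐 : Finset (Finset ℕ)} {Z : Finset ℕ} :
    1 ∈ decodeSet n 𝓐 Z ↔ ¬ IsLow 𝓐 Z := by
  by_cases h : IsLow 𝓐 Z
  · simp [decodeSet_of_isLow h, h]
  · simp [decodeSet_of_not_isLow h, h]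

lemma one_notMem_of_subset {n : ℕ} {Z : Finset ℕ} (h : Z ⊆ Icc 2 n) : 1 ∉ Z := fun h1 => by
  have := h h1
  simp at this

lemma eq_and_isLow_iff_of_decodeSet_eq {n : ℕ} {𝓐 𝓑 : Finset (Finset ℕ)} {Z W : Finset ℕ}
    (hZ : Z ⊆ Icc 2 n) (hW : W ⊆ Icc 2 n) (h : decodeSet n 𝓐 Z = decodeSet n 𝓑 W) :
    Z = W ∧ (IsLow 𝓐 Z ↔ IsLow 𝓑 W) := by
  have hl : IsLow 𝓐 Z ↔ IsLow 𝓑 W := by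
    rw [← not_iff_not, ← one_mem_decodeSet (n := n), h, one_mem_decodeSet]
  refine ⟨?_, hl⟩
  by_cases hZl : IsLow 𝓐 Z
  · rw [decodeSet_of_isLow hZl, decodeSet_of_isLow (hl.1 hZl)] at h
    rw [← Finset.sdiff_sdiff_eq_self hZ, h, Finset.sdiff_sdiff_eq_self hW]
  · rw [decodeSet_of_not_isLow hZl, decodeSet_of_not_isLow (fun h => hZl (hl.2 h))] at h
    rw [← erase_insert (one_notMem_of_subset hZ), h, erase_insert (one_notMem_of_subset hW)]

lemma mem_star {j : ℕ} {B : Finset ℕ} :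
    B ∈ (star j : Finset (Finset ℕ)) ↔ ∃ t, (2 ≤ t ∧ t ≤ j + 1) ∧ ({1, t} : Finset ℕ) = B := by
  simp [_root_.star]

lemma card_of_mem_star {j : ℕ} {B : Finset ℕ} (h : B ∈ (star j : Finset (Finset ℕ))) :
    B.card = 2 := by
  obtain ⟨t, ht, rfl⟩ := mem_star.1 h
  exact card_pair (by omega)

lemma card_star (j : ℕ) : (star j : Finset (Finset ℕ)).card = j := by
  unfold _root_.star
  rw [card_image_of_injOn]
  · simp
  · intro t ht u hu h
    simp only [coe_Icc, Set.mem_Icc] at ht hu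
    have : t ∈ ({1, u} : Finset ℕ) := by
      rw [← show ({1, t} : Finset ℕ) = {1, u} from h]; simp
    simp only [mem_insert, mem_singleton] at this
    omega

lemma subset_Icc_of_isLow {n j : ℕ} {𝓐 : Finset (Finset ℕ)} {Z : Finset ℕ}
    (hA : 𝓐 ∈ bigAntichains (Icc (j + 2) n)) (hZ : Z ∈ codeSets n j) (h : IsLow 𝓐 Z) :
    Z ⊆ Icc (j + 2) n := by
  rcases h with h | ⟨a, ha, hZa⟩
  · rcases (mem_codeSets.1 hZ).2 with h2 | h2
    · omega
    · exact h2
  · exact hZa.trans ((mem_bigAntichains.1 hA).1 a ha).1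

lemma mem_decodeSet_of_isLow {n j t : ℕ} {𝓐 : Finset (Finset ℕ)} {Z : Finset ℕ} (hj : j + 1 ≤ n)
    (hA : 𝓐 ∈ bigAntichains (Icc (j + 2) n)) (hZ : Z ∈ codeSets n j) (h : IsLow 𝓐 Z)
    (ht : 2 ≤ t) (ht' : t ≤ j + 1) : t ∈ decodeSet n 𝓐 Z := by
  rw [decodeSet_of_isLow h, mem_sdiff, mem_Icc]
  refine ⟨by omega, fun htZ => ?_⟩
  have := subset_Icc_of_isLow hA hZ h htZ
  rw [mem_Icc] at this
  omega

lemma three_le_card_decodeSet {n j : ℕ} {𝓐 : Finset (Finset ℕ)} {Z : Finset ℕ} (hj3 : 3 ≤ j)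
    (hj : j + 1 ≤ n) (hA : 𝓐 ∈ bigAntichains (Icc (j + 2) n)) (hZ : Z ∈ codeSets n j) :
    3 ≤ (decodeSet n 𝓐 Z).card := by
  by_cases h : IsLow 𝓐 Z
  · have : Icc 2 (j + 1) ⊆ decodeSet n 𝓐 Z := fun t ht => by
      rw [mem_Icc] at ht
      exact mem_decodeSet_of_isLow hj hA hZ h ht.1 ht.2
    have := card_le_card this
    simp at this
    omega
  · rw [decodeSet_of_not_isLow h,
      card_insert_of_notMem (one_notMem_of_subset (mem_codeSets.1 hZ).1)]
    have : ¬ Z.card ≤ 1 := fun h' => h (Or.inl h')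
    omega

lemma card_decodeFam {n j : ℕ} {𝓐 T : Finset (Finset ℕ)} (hj3 : 3 ≤ j)
    (hj : j + 1 ≤ n) (hA : 𝓐 ∈ bigAntichains (Icc (j + 2) n)) (hT : T ⊆ codeSets n j) :
    (decodeFam n j 𝓐 T).card = T.card + j := by
  unfold decodeFam
  rw [card_union_of_disjoint, card_star, card_image_of_injOn, add_comm]
  · intro Z hZ W hW h
    exact (eq_and_isLow_iff_of_decodeSet_eq (mem_codeSets.1 (hT hZ)).1
      (mem_codeSets.1 (hT hW)).1 h).1
  · rw [disjoint_left]
    intro B hB hB'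
    obtain ⟨Z, hZ, rfl⟩ := mem_image.1 hB'
    have := three_le_card_decodeSet hj3 hj hA (hT hZ)
    have := card_of_mem_star hB
    omega

lemma mem_interLayerFams {n s : ℕ} {S 𝓔 : Finset (Finset ℕ)} :
    𝓔 ∈ interLayerFams n s S ↔ (∀ B ∈ 𝓔, B ⊆ Icc 1 n ∧ 2 ≤ B.card) ∧ 𝓔.card = s ∧
      (∀ B ∈ 𝓔, ∀ B' ∈ 𝓔, (B ∩ B').Nonempty) ∧
      (∀ B, B ∈ S ↔ B ∈ 𝓔 ∧ B ⊆ Icc 1 n ∧ B.card = 2) := by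
  have : 𝓔 ∩ layerEQ n 2 = S ↔ ∀ B, B ∈ S ↔ B ∈ 𝓔 ∧ B ⊆ Icc 1 n ∧ B.card = 2 := by
    rw [Finset.ext_iff]
    refine forall_congr' fun B => ?_
    rw [mem_inter, layerEQ, mem_powersetCard, groundSet]
    exact Iff.comm
  simp only [interLayerFams, mem_filter, this, mem_powersetCard, and_assoc]
  refine and_congr_left' ?_
  simp [layerGE, allFams, groundSet, subset_iff (s₁ := 𝓔)]

lemma decodeFam_mem_interLayerFams {n j : ℕ} {𝓐 T : Finset (Finset ℕ)} (hj3 : 3 ≤ j)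
    (hj : j + 1 ≤ n) (hA : 𝓐 ∈ bigAntichains (Icc (j + 2) n)) (hT : T ⊆ codeSets n j) :
    decodeFam n j 𝓐 T ∈ interLayerFams n (T.card + j) (star j) := by
  have hstar : ∀ B ∈ (star j : Finset (Finset ℕ)), B ⊆ Icc 1 n := by
    intro B hB
    obtain ⟨t, ht, rfl⟩ := mem_star.1 hB
    intro x hx
    simp only [mem_insert, mem_singleton] at hx
    rw [mem_Icc]
    omega
  have hdec : ∀ Z ∈ T, decodeSet n 𝓐 Z ⊆ Icc 1 n := by
    intro Z hZ
    have hG : Icc 2 n ⊆ Icc 1 n := Icc_subset_Icc_left (by omega)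
    by_cases h : IsLow 𝓐 Z
    · rw [decodeSet_of_isLow h]
      exact sdiff_subset.trans hG
    · rw [decodeSet_of_not_isLow h]
      exact insert_subset (mem_Icc.2 (by omega)) ((mem_codeSets.1 (hT hZ)).1.trans hG)
  have hmixed : ∀ Z ∈ T, ∀ W ∈ T, IsLow 𝓐 Z → ¬ IsLow 𝓐 W →
      (decodeSet n 𝓐 Z ∩ decodeSet n 𝓐 W).Nonempty := by
    intro Z hZ W hW h h'
    by_contra hne
    rw [not_nonempty_iff_eq_empty, ← disjoint_iff_inter_eq_empty, disjoint_left,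
      decodeSet_of_isLow h, decodeSet_of_not_isLow h'] at hne
    have hWZ : W ⊆ Z := by
      intro x hx
      by_contra hxZ
      exact hne (mem_sdiff.2 ⟨(mem_codeSets.1 (hT hW)).1 hx, hxZ⟩) (mem_insert_of_mem hx)
    rcases h with h | ⟨a, ha, hZa⟩
    · exact h' (Or.inl ((card_le_card hWZ).trans h))
    · exact h' (Or.inr ⟨a, ha, hWZ.trans hZa⟩)
  have hstardec : ∀ B ∈ (star j : Finset (Finset ℕ)), ∀ Z ∈ T,
      (B ∩ decodeSet n 𝓐 Z).Nonempty := by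
    intro B hB Z hZ
    obtain ⟨t, ht, rfl⟩ := mem_star.1 hB
    by_cases h : IsLow 𝓐 Z
    · exact ⟨t, mem_inter.2 ⟨by simp, mem_decodeSet_of_isLow hj hA (hT hZ) h ht.1 ht.2⟩⟩
    · exact ⟨1, mem_inter.2 ⟨by simp, one_mem_decodeSet.2 h⟩⟩
  rw [mem_interLayerFams]
  refine ⟨?_, card_decodeFam hj3 hj hA hT, ?_, ?_⟩
  · intro B hB
    rcases mem_union.1 hB with hB | hB
    · exact ⟨hstar B hB, (card_of_mem_star hB).ge⟩
    · obtain ⟨Z, hZ, rfl⟩ := mem_image.1 hB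
      have := three_le_card_decodeSet hj3 hj hA (hT hZ)
      exact ⟨hdec Z hZ, by omega⟩
  · intro B hB B' hB'
    rcases mem_union.1 hB with hB | hB <;> rcases mem_union.1 hB' with hB' | hB'
    · obtain ⟨t, ht, rfl⟩ := mem_star.1 hB
      obtain ⟨t', ht', rfl⟩ := mem_star.1 hB'
      exact ⟨1, by simp⟩
    · obtain ⟨Z, hZ, rfl⟩ := mem_image.1 hB'
      exact hstardec B hB Z hZ
    · obtain ⟨Z, hZ, rfl⟩ := mem_image.1 hB
      rw [inter_comm]
      exact hstardec B' hB' Z hZ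
    · obtain ⟨Z, hZ, rfl⟩ := mem_image.1 hB
      obtain ⟨W, hW, rfl⟩ := mem_image.1 hB'
      by_cases h : IsLow 𝓐 Z <;> by_cases h' : IsLow 𝓐 W
      · exact ⟨2, mem_inter.2
          ⟨mem_decodeSet_of_isLow hj hA (hT hZ) h le_rfl (by omega),
            mem_decodeSet_of_isLow hj hA (hT hW) h' le_rfl (by omega)⟩⟩
      · exact hmixed Z hZ W hW h h'
      · rw [inter_comm]
        exact hmixed W hW Z hZ h' h
      · exact ⟨1, mem_inter.2 ⟨one_mem_decodeSet.2 h, one_mem_decodeSet.2 h'⟩⟩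
  · intro B
    constructor
    · intro hB
      exact ⟨mem_union_left _ hB, hstar B hB, card_of_mem_star hB⟩
    · rintro ⟨hB, -, hB2⟩
      rcases mem_union.1 hB with hB | hB
      · exact hB
      · obtain ⟨Z, hZ, rfl⟩ := mem_image.1 hB
        have := three_le_card_decodeSet hj3 hj hA (hT hZ)
        omega

lemma decodeFam_injective {n j : ℕ} {𝓐 𝓑 T S : Finset (Finset ℕ)} (hj3 : 3 ≤ j)
    (hj : j + 1 ≤ n) (hA : 𝓐 ∈ bigAntichains (Icc (j + 2) n))
    (hB : 𝓑 ∈ bigAntichains (Icc (j + 2) n)) (hT : T ⊆ codeSets n j) (hS : S ⊆ codeSets n j)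
    (hAT : 𝓐 ⊆ T) (hBS : 𝓑 ⊆ S) (he : decodeFam n j 𝓐 T = decodeFam n j 𝓑 S) :
    𝓐 = 𝓑 ∧ T = S := by
  have transfer : ∀ {𝓐 𝓑 T S : Finset (Finset ℕ)}, 𝓐 ∈ bigAntichains (Icc (j + 2) n) →
      T ⊆ codeSets n j → S ⊆ codeSets n j →
      decodeFam n j 𝓐 T = decodeFam n j 𝓑 S → ∀ Z ∈ T, Z ∈ S ∧ (IsLow 𝓐 Z ↔ IsLow 𝓑 Z) := by
    intro 𝓐 𝓑 T S hA hT hS he Z hZ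
    have hm : decodeSet n 𝓐 Z ∈ decodeFam n j 𝓑 S :=
      he ▸ mem_union_right _ (mem_image_of_mem _ hZ)
    rcases mem_union.1 hm with h | h
    · have := card_of_mem_star h
      have := three_le_card_decodeSet hj3 hj hA (hT hZ)
      omega
    · obtain ⟨W, hW, hWZ⟩ := mem_image.1 h
      obtain ⟨rfl, hl⟩ := eq_and_isLow_iff_of_decodeSet_eq (mem_codeSets.1 (hS hW)).1
        (mem_codeSets.1 (hT hZ)).1 hWZ
      exact ⟨hW, hl.symm⟩
  have sub : ∀ {𝓐 𝓑 T S : Finset (Finset ℕ)}, 𝓐 ∈ bigAntichains (Icc (j + 2) n) →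
      𝓑 ∈ bigAntichains (Icc (j + 2) n) → T ⊆ codeSets n j → S ⊆ codeSets n j →
      𝓐 ⊆ T → 𝓑 ⊆ S → decodeFam n j 𝓐 T = decodeFam n j 𝓑 S → 𝓐 ⊆ 𝓑 := by
    intro 𝓐 𝓑 T S hA hB hT hS hAT hBS he a ha
    have ha2 := ((mem_bigAntichains.1 hA).1 a ha).2
    have hl := (transfer hA hT hS he a (hAT ha)).2.1 (Or.inr ⟨a, ha, Subset.rfl⟩)
    rcases hl with hl | ⟨b, hb, hab⟩
    · omega
    have hb2 := ((mem_bigAntichains.1 hB).1 b hb).2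
    have hl := (transfer hB hS hT he.symm b (hBS hb)).2.1 (Or.inr ⟨b, hb, Subset.rfl⟩)
    rcases hl with hl | ⟨c, hc, hbc⟩
    · omega
    have hac := (mem_bigAntichains.1 hA).2 a ha c hc (hab.trans hbc)
    subst hac
    rwa [Subset.antisymm hab hbc]
  exact ⟨Subset.antisymm (sub hA hB hT hS hAT hBS he) (sub hB hA hS hT hBS hAT he.symm),
    Subset.antisymm (fun Z hZ => (transfer hA hT hS he Z hZ).1)
      (fun Z hZ => (transfer hB hS hT he.symm Z hZ).1)⟩

lemma exists_decodeFam_eq {n j s : ℕ} {𝓔 : Finset (Finset ℕ)}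
    (hE : 𝓔 ∈ interLayerFams n s (star j)) :
    ∃ 𝓐 ∈ bigAntichains (Icc (j + 2) n), ∃ T ⊆ codeSets n j, 𝓐 ⊆ T ∧ decodeFam n j 𝓐 T = 𝓔 := by
  classical
  obtain ⟨hE2, -, hint, hstar⟩ := mem_interLayerFams.1 hE
  set 𝓒 := (Icc (j + 2) n).powerset.filter fun C => 2 ≤ C.card ∧ Icc 2 n \ C ∈ 𝓔 with h𝓒
  have mem𝓒 : ∀ C, C ∈ 𝓒 ↔ C ⊆ Icc (j + 2) n ∧ 2 ≤ C.card ∧ Icc 2 n \ C ∈ 𝓔 := by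
    simp [h𝓒]
  set 𝓐 := 𝓒.filter fun C => ∀ D ∈ 𝓒, C ⊆ D → C = D with h𝓐
  set T := (codeSets n j).filter fun Z => (2 ≤ Z.card ∧ insert 1 Z ∈ 𝓔) ∨ Icc 2 n \ Z ∈ 𝓔
    with hTdef
  have hMG : Icc (j + 2) n ⊆ Icc 2 n := Icc_subset_Icc_left (by omega)
  have hlow : ∀ Z ⊆ Icc 2 n, Icc 2 n \ Z ∈ 𝓔 → Z ⊆ Icc (j + 2) n := by
    intro Z hZ hZE x hx
    have hxG := mem_Icc.1 (hZ hx)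
    rw [mem_Icc]
    refine ⟨?_, hxG.2⟩
    by_contra hlt
    have hs : ({1, x} : Finset ℕ) ∈ 𝓔 :=
      ((hstar _).1 (mem_star.2 ⟨x, ⟨hxG.1, by omega⟩, rfl⟩)).1
    obtain ⟨y, hy⟩ := hint _ hs _ hZE
    rw [mem_inter, mem_insert, mem_singleton, mem_sdiff, mem_Icc] at hy
    rcases hy with ⟨rfl | rfl, hy, hy'⟩
    · omega
    · exact hy' hx
  have isLow : ∀ Z ⊆ Icc 2 n, Icc 2 n \ Z ∈ 𝓔 → IsLow 𝓐 Z := by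
    intro Z hZ hZE
    by_cases hc : Z.card ≤ 1
    · exact Or.inl hc
    obtain ⟨D, hZD, hD⟩ := 𝓒.exists_le_maximal ((mem𝓒 Z).2 ⟨hlow Z hZ hZE, by omega, hZE⟩)
    refine Or.inr ⟨D, mem_filter.2 ⟨hD.prop, fun F hF hDF => ?_⟩, hZD⟩
    exact Subset.antisymm hDF (hD.le_of_ge hF hDF)
  have notLow : ∀ Z, 2 ≤ Z.card → insert 1 Z ∈ 𝓔 → ¬ IsLow 𝓐 Z := by
    rintro Z hZ2 hZE (h | ⟨a, ha, hZa⟩)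
    · omega
    · obtain ⟨y, hy⟩ := hint _ hZE _ ((mem𝓒 a).1 (mem_filter.1 ha).1).2.2
      rw [mem_inter, mem_insert, mem_sdiff, mem_Icc] at hy
      rcases hy with ⟨rfl | hy, hyG, hya⟩
      · omega
      · exact hya (hZa hy)
  refine ⟨𝓐, ?_, T, filter_subset _ _, ?_, ?_⟩
  · rw [mem_bigAntichains]
    constructor
    · intro a ha
      have := (mem𝓒 a).1 (mem_filter.1 ha).1
      exact ⟨this.1, this.2.1⟩
    · intro a ha b hb hab
      exact (mem_filter.1 ha).2 b (mem_filter.1 hb).1 hab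
  · intro a ha
    have h := (mem𝓒 a).1 (mem_filter.1 ha).1
    exact mem_filter.2 ⟨mem_codeSets.2 ⟨h.1.trans hMG, Or.inl h.2.1⟩, Or.inr h.2.2⟩
  · apply Subset.antisymm
    · intro B hB
      rcases mem_union.1 hB with hB | hB
      · exact ((hstar B).1 hB).1
      · obtain ⟨Z, hZ, rfl⟩ := mem_image.1 hB
        obtain ⟨hZU, ⟨hZ2, hZE⟩ | hZE⟩ := mem_filter.1 hZ
        · rwa [decodeSet_of_not_isLow (notLow Z hZ2 hZE)]
        · rwa [decodeSet_of_isLow (isLow Z (mem_codeSets.1 hZU).1 hZE)]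
    · intro B hB
      obtain ⟨hBn, hB2⟩ := hE2 B hB
      by_cases hc : B.card = 2
      · exact mem_union_left _ ((hstar B).2 ⟨hB, hBn, hc⟩)
      refine mem_union_right _ (mem_image.2 ?_)
      by_cases h1 : 1 ∈ B
      · have hins : insert 1 (B.erase 1) = B := insert_erase h1
        have hcard : 2 ≤ (B.erase 1).card := by
          rw [card_erase_of_mem h1]
          omega
        have hsub : B.erase 1 ⊆ Icc 2 n := by
          intro x hx
          rw [mem_erase] at hx
          have := mem_Icc.1 (hBn hx.2)
          rw [mem_Icc]
          omega
        refine ⟨B.erase 1, mem_filter.2 ⟨mem_codeSets.2 ⟨hsub, Or.inl hcard⟩,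
          Or.inl ⟨hcard, by rwa [hins]⟩⟩, ?_⟩
        rw [decodeSet_of_not_isLow (notLow _ hcard (by rwa [hins])), hins]
      · have hsub : B ⊆ Icc 2 n := by
          intro x hx
          have := mem_Icc.1 (hBn hx)
          have : x ≠ 1 := fun h => h1 (h ▸ hx)
          rw [mem_Icc]
          omega
        have hcc : Icc 2 n \ (Icc 2 n \ B) = B := Finset.sdiff_sdiff_eq_self hsub
        have hE' : Icc 2 n \ (Icc 2 n \ B) ∈ 𝓔 := by rwa [hcc]
        refine ⟨Icc 2 n \ B, mem_filter.2 ⟨mem_codeSets.2 ⟨sdiff_subset,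
          Or.inr (hlow _ sdiff_subset hE')⟩, Or.inr hE'⟩, ?_⟩
        rw [decodeSet_of_isLow (isLow _ sdiff_subset hE'), hcc]

lemma card_interLayerFams_star {n j : ℕ} (a : ℕ) (hj3 : 3 ≤ j) (hj : j + 1 ≤ n) :
    (interLayerFams n (a + j) (star j)).card = ∑ 𝓐 ∈ bigAntichains (Icc (j + 2) n),
      (((codeSets n j).powersetCard a).filter fun T => 𝓐 ⊆ T).card := by
  rw [← card_sigma]
  symm
  refine card_bij (fun p _ => decodeFam n j p.1 p.2) ?_ ?_ ?_
  · rintro ⟨𝓐, T⟩ h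
    simp only [mem_sigma, mem_filter, mem_powersetCard] at h
    obtain ⟨hA, ⟨hT, rfl⟩, -⟩ := h
    exact decodeFam_mem_interLayerFams hj3 hj hA hT
  · rintro ⟨𝓐, T⟩ h ⟨𝓑, S⟩ h' he
    simp only [mem_sigma, mem_filter, mem_powersetCard] at h h'
    obtain ⟨rfl, rfl⟩ := decodeFam_injective hj3 hj h.1 h'.1 h.2.1.1 h'.2.1.1 h.2.2 h'.2.2 he
    rfl
  · intro 𝓔 hE
    obtain ⟨𝓐, hA, T, hT, hAT, rfl⟩ := exists_decodeFam_eq hE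
    refine ⟨⟨𝓐, T⟩, ?_, rfl⟩
    simp only [mem_sigma, mem_filter, mem_powersetCard]
    have h1 := card_decodeFam hj3 hj hA hT
    have h2 := (mem_interLayerFams.1 hE).2.1
    exact ⟨hA, ⟨hT, by omega⟩, hAT⟩

lemma bigAntichain_subset_codeSets {n j : ℕ} {𝓐 : Finset (Finset ℕ)}
    (hA : 𝓐 ∈ bigAntichains (Icc (j + 2) n)) : 𝓐 ⊆ codeSets n j := fun a ha => by
  have h := (mem_bigAntichains.1 hA).1 a ha
  exact mem_codeSets.2 ⟨h.1.trans (Icc_subset_Icc_left (by omega)), Or.inl h.2⟩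

lemma insert_Icc_succ {j n : ℕ} (h : j + 2 ≤ n) :
    insert (j + 2) (Icc (j + 1 + 2) n) = Icc (j + 2) n := by
  ext x
  simp only [mem_insert, mem_Icc]
  omega

lemma card_codeSets_succ {n j : ℕ} (h : j + 2 ≤ n) :
    (codeSets n j).card = (codeSets n (j + 1)).card + 1 := by
  have hnot : ({j + 2} : Finset ℕ) ∉ codeSets n (j + 1) := by
    simp [mem_codeSets]
  rw [← card_insert_of_notMem hnot]
  congr 1
  ext Z
  rw [mem_insert, mem_codeSets, mem_codeSets, ← insert_Icc_succ h]
  constructor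
  · rintro ⟨hZ, h2 | hZM⟩
    · exact Or.inr ⟨hZ, Or.inl h2⟩
    · by_cases hm : j + 2 ∈ Z
      · by_cases h2 : 2 ≤ Z.card
        · exact Or.inr ⟨hZ, Or.inl h2⟩
        · left
          exact (eq_of_subset_of_card_le (singleton_subset_iff.2 hm) (by simp; omega)).symm
      · exact Or.inr ⟨hZ, Or.inr ((subset_insert_iff_of_notMem hm).1 hZM)⟩
  · rintro (rfl | ⟨hZ, h2 | hZM⟩)
    · simp
      omega
    · exact ⟨hZ, Or.inl h2⟩
    · exact ⟨hZ, Or.inr (hZM.trans (subset_insert _ _))⟩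

theorem stmt11 (n s r : ℕ) (hn : 21 ≤ n) (hs : 1 ≤ s) (hr1 : 4 ≤ r) (hr2 : r ≤ n - 1) :
    (2 ^ (n - r - 1) - (n - r)) * (interLayerFams n s (star r)).card ≤
      2 * (interLayerFams n s (star (r - 1))).card := by
  obtain ⟨j, rfl⟩ : ∃ j, r = j + 1 := ⟨r - 1, by omega⟩
  rw [Nat.add_sub_cancel]
  rcases lt_or_ge s (j + 1) with hlt | hge
  · have : interLayerFams n s (star (j + 1)) = ∅ := by
      rw [eq_empty_iff_forall_notMem]
      intro 𝓔 hE
      obtain ⟨-, hc, -, hS⟩ := mem_interLayerFams.1 hE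
      have := card_le_card (fun B hB => ((hS B).1 hB).1 : _root_.star (j + 1) ⊆ 𝓔)
      rw [card_star] at this
      omega
    simp [this]
  obtain ⟨a, rfl⟩ := Nat.exists_eq_add_of_le' hge
  have hK : 2 ^ (n - (j + 1) - 1) - (n - (j + 1)) =
      ((Icc (j + 1 + 2) n).powerset.filter fun A => 2 ≤ A.card).card := by
    rw [card_powerset_filter_two_le, Nat.card_Icc]
    congr 1
    · congr 1
      omega
    · omega
  have e : a + (j + 1) = (a + 1) + j := by omega
  have hjn : j + 2 ≤ n := by omega
  have hj3 : 3 ≤ j := by omega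
  rw [hK, card_interLayerFams_star a (by omega) hjn, e,
    card_interLayerFams_star (a + 1) hj3 (by omega), ← insert_Icc_succ hjn]
  refine card_mul_sum_bigAntichains_le (by simp) _ _ fun 𝓐 hA 𝓑 hB hc => ?_
  rw [insert_Icc_succ hjn] at hB
  exact card_superset_le (card_codeSets_succ hjn) (bigAntichain_subset_codeSets hA)
    (bigAntichain_subset_codeSets hB) hc
end

section
/- Let n ≥ 4 be even, let s be an integer with 2 ≤ s ≤ 2^(n−1), and set ℓ = n/2 − 1. Suppose 𝓐 is a family of subsets of [n] satisfying [n]^(≥ℓ+1) \ {[n−ℓ, n]} ⊆ 𝓐, [n−ℓ, n] ∉ 𝓐 and [ℓ] ∈ 𝓐. Then there exists a (U,v,f)-compression C such that |𝕀^(s)(C(𝓐))| > |𝕀^(s)(𝓐)|. -/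
open Finset

/-- The `(U,v,f)`-compression of a single set `A` (with `v ∉ A`):
`C(A) = (A \ U) ∪ {v} ∪ f(A ∩ U)`. -/
def cSet (U : Finset ℕ) (v : ℕ) (f : ℕ → ℕ) (A : Finset ℕ) : Finset ℕ :=
  (A \ U) ∪ {v} ∪ (A ∩ U).image f

/-- The `(U,v,f)`-compression of a family: each `A ∈ 𝓐` with `v ∉ A` is replaced by
`cSet U v f A` provided this set is not already in `𝓐`. -/
def cFam (U : Finset ℕ) (v : ℕ) (f : ℕ → ℕ) (𝓐 : Finset (Finset ℕ)) :
    Finset (Finset ℕ) :=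
  𝓐.image fun A => if v ∉ A ∧ cSet U v f A ∉ 𝓐 then cSet U v f A else A

/-- The data of a valid `(U,v,f)`-compression on `[n]`. -/
def IsUVF (n : ℕ) (U : Finset ℕ) (v : ℕ) (f : ℕ → ℕ) : Prop :=
  U ⊆ Finset.Icc 1 n ∧ Even U.card ∧ v ∈ Finset.Icc 1 n ∧ v ∉ U ∧
    (∀ x ∈ U, f x ∈ U) ∧ (∀ x ∈ U, f (f x) = x) ∧ ∀ x ∈ U, f x ≠ x

section Compression

variable {U : Finset ℕ} {v : ℕ} {f : ℕ → ℕ} {A B : Finset ℕ} {𝓐 𝓔 𝓕 : Finset (Finset ℕ)}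

theorem mem_cSet (hU : ∀ x ∈ U, f x ∈ U) (hf : ∀ x ∈ U, f (f x) = x) {x : ℕ} :
    x ∈ cSet U v f A ↔ x = v ∨ (x ∉ U ∧ x ∈ A) ∨ (x ∈ U ∧ f x ∈ A) := by
  simp only [cSet, mem_union, mem_sdiff, mem_singleton, mem_image, mem_inter]
  constructor
  · rintro ((⟨h1, h2⟩ | h) | ⟨y, ⟨hy, hyU⟩, rfl⟩)
    · exact Or.inr (Or.inl ⟨h2, h1⟩)
    · exact Or.inl h
    · exact Or.inr (Or.inr ⟨hU y hyU, by rwa [hf y hyU]⟩)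
  · rintro (h | ⟨h1, h2⟩ | ⟨h1, h2⟩)
    · exact Or.inl (Or.inr h)
    · exact Or.inl (Or.inl ⟨h2, h1⟩)
    · exact Or.inr ⟨f x, ⟨h2, hU x h1⟩, hf x h1⟩

theorem self_mem_cSet : v ∈ cSet U v f A := by
  simp [cSet]

theorem cSet_injective (hv : v ∉ U) (hU : ∀ x ∈ U, f x ∈ U) (hf : ∀ x ∈ U, f (f x) = x)
    (hA : v ∉ A) (hB : v ∉ B) (h : cSet U v f A = cSet U v f B) : A = B := by
  have key : ∀ x, x ∈ cSet U v f A ↔ x ∈ cSet U v f B := fun x => by rw [h]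
  simp only [mem_cSet hU hf] at key
  ext x
  by_cases hx : x ∈ U
  · have h1 := key (f x)
    have h2 := hU x hx
    rw [hf x hx] at h1
    grind
  · have h1 := key x
    grind

/-- The relation `C(A) ∩ B = ∅` is symmetric among sets avoiding `v`. -/
theorem disjoint_cSet_comm (hU : ∀ x ∈ U, f x ∈ U) (hf : ∀ x ∈ U, f (f x) = x)
    (hA : v ∉ A) (h : Disjoint (cSet U v f A) B) : Disjoint A (cSet U v f B) := by
  rw [Finset.disjoint_left] at h ⊢
  intro x hxA hxB
  rw [mem_cSet hU hf] at hxB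
  rcases hxB with rfl | ⟨h1, h2⟩ | ⟨h1, h2⟩
  · exact hA hxA
  · exact h ((mem_cSet hU hf).2 (Or.inr (Or.inl ⟨h1, hxA⟩))) h2
  · exact h ((mem_cSet hU hf).2 (Or.inr (Or.inr ⟨hU x h1, by rwa [hf x h1]⟩))) h2

theorem card_lt_card_cSet (hv : v ∉ U) (hf : ∀ x ∈ U, f (f x) = x) (hU : ∀ x ∈ U, f x ∈ U)
    (hA : v ∉ A) : A.card < (cSet U v f A).card := by
  have h : A.card ≤ ((cSet U v f A).erase v).card := by
    refine Finset.card_le_card_of_injOn (fun x => if x ∈ U then f x else x) ?_ ?_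
    · intro x hx
      have hx' : x ∈ A := hx
      simp only [coe_erase, Set.mem_sdiff, mem_coe, Set.mem_singleton_iff, mem_cSet hU hf]
      have h1 := hU x
      have h2 := hf x
      grind
    · intro x _ y _ hxy
      have h1 := hU x
      have h2 := hf x
      have h3 := hU y
      have h4 := hf y
      simp only at hxy
      grind
  rw [card_erase_of_mem self_mem_cSet] at h
  have : 0 < (cSet U v f A).card := card_pos.2 ⟨v, self_mem_cSet⟩
  omega

/-- The members of `𝓔` that have to be compressed when `𝓔 ⊆ 𝓐` is transported to `C(𝓐)`: those
moved by the compression of `𝓐`, and recursively those avoiding `v` and disjoint from the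
compression of such a set. -/
inductive MustCompress (U : Finset ℕ) (v : ℕ) (f : ℕ → ℕ) (𝓐 𝓔 : Finset (Finset ℕ)) :
    Finset ℕ → Prop
  | moved {A : Finset ℕ} : A ∈ 𝓔 → v ∉ A → cSet U v f A ∉ 𝓐 → MustCompress U v f 𝓐 𝓔 A
  | forced {A B : Finset ℕ} : MustCompress U v f 𝓐 𝓔 A → B ∈ 𝓔 → v ∉ B →
      Disjoint (cSet U v f A) B → MustCompress U v f 𝓐 𝓔 B

theorem MustCompress.mem (h : MustCompress U v f 𝓐 𝓔 A) : A ∈ 𝓔 := by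
  cases h <;> assumption

theorem MustCompress.notMem (h : MustCompress U v f 𝓐 𝓔 A) : v ∉ A := by
  cases h <;> assumption

open Classical in
/-- The intersecting subfamily of `C(𝓐)` associated with an intersecting subfamily of `𝓐`. -/
noncomputable def transport (U : Finset ℕ) (v : ℕ) (f : ℕ → ℕ) (𝓐 𝓔 : Finset (Finset ℕ)) :
    Finset (Finset ℕ) :=
  𝓔.image fun A => if MustCompress U v f 𝓐 𝓔 A then cSet U v f A else A

theorem mem_transport : B ∈ transport U v f 𝓐 𝓔 ↔
    (∃ A, MustCompress U v f 𝓐 𝓔 A ∧ cSet U v f A = B) ∨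
      (B ∈ 𝓔 ∧ ¬ MustCompress U v f 𝓐 𝓔 B) := by
  simp only [transport, mem_image]
  constructor
  · rintro ⟨A, hA, rfl⟩
    split_ifs with h
    · exact Or.inl ⟨A, h, rfl⟩
    · exact Or.inr ⟨hA, h⟩
  · rintro (⟨A, hA, rfl⟩ | ⟨hB, h⟩)
    · exact ⟨A, hA.mem, if_pos hA⟩
    · exact ⟨B, hB, if_neg h⟩

theorem mem_cFam_of_mem (hA : A ∈ 𝓐) (h : v ∈ A ∨ cSet U v f A ∈ 𝓐) : A ∈ cFam U v f 𝓐 :=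
  mem_image.2 ⟨A, hA, if_neg (by tauto)⟩

theorem cSet_mem_cFam (hA : A ∈ 𝓐) (hv : v ∉ A) : cSet U v f A ∈ cFam U v f 𝓐 := by
  by_cases h : cSet U v f A ∈ 𝓐
  · exact mem_cFam_of_mem h (Or.inl self_mem_cSet)
  · exact mem_image.2 ⟨A, hA, if_pos ⟨hv, h⟩⟩

/-- `𝓔` is intersecting. -/
def IsInter (𝓔 : Finset (Finset ℕ)) : Prop := ∀ B ∈ 𝓔, ∀ B' ∈ 𝓔, (B ∩ B').Nonempty

theorem IsInter.not_disjoint (h : IsInter 𝓔) (hA : A ∈ 𝓔) (hB : B ∈ 𝓔) : ¬ Disjoint A B := by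
  rw [Finset.disjoint_iff_inter_eq_empty]
  exact (h A hA B hB).ne_empty

theorem MustCompress.cSet_notMem (hU : ∀ x ∈ U, f x ∈ U) (hf : ∀ x ∈ U, f (f x) = x)
    (hsub : 𝓔 ⊆ 𝓐) (hI : IsInter 𝓔) (h : MustCompress U v f 𝓐 𝓔 A) : cSet U v f A ∉ 𝓔 := by
  intro hmem
  cases h with
  | moved hA hv hC => exact hC (hsub hmem)
  | forced hB _ _ hd =>
    exact hI.not_disjoint hB.mem hmem (disjoint_cSet_comm hU hf hB.notMem hd)

theorem card_transport (hv : v ∉ U) (hU : ∀ x ∈ U, f x ∈ U) (hf : ∀ x ∈ U, f (f x) = x)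
    (hsub : 𝓔 ⊆ 𝓐) (hI : IsInter 𝓔) : (transport U v f 𝓐 𝓔).card = 𝓔.card := by
  refine card_image_of_injOn ?_
  intro A hA B hB hAB
  simp only at hAB
  split_ifs at hAB with h1 h2 h2
  · exact cSet_injective hv hU hf h1.notMem h2.notMem hAB
  · exact absurd (hAB ▸ hB) (h1.cSet_notMem hU hf hsub hI)
  · exact absurd (hAB ▸ hA) (h2.cSet_notMem hU hf hsub hI)
  · exact hAB

theorem transport_subset (hsub : 𝓔 ⊆ 𝓐) : transport U v f 𝓐 𝓔 ⊆ cFam U v f 𝓐 := by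
  intro B hB
  rcases mem_transport.1 hB with ⟨A, hA, rfl⟩ | ⟨hB, h⟩
  · exact cSet_mem_cFam (hsub hA.mem) hA.notMem
  · refine mem_cFam_of_mem (hsub hB) ?_
    by_contra! hc
    exact h (.moved hB hc.1 hc.2)

theorem isInter_transport (hI : IsInter 𝓔) : IsInter (transport U v f 𝓐 𝓔) := by
  have mixed : ∀ A B, MustCompress U v f 𝓐 𝓔 A → B ∈ 𝓔 → ¬ MustCompress U v f 𝓐 𝓔 B →
      (cSet U v f A ∩ B).Nonempty := by
    intro A B hA hB h
    by_cases hvB : v ∈ B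
    · exact ⟨v, mem_inter.2 ⟨self_mem_cSet, hvB⟩⟩
    · by_contra hne
      rw [not_nonempty_iff_eq_empty, ← Finset.disjoint_iff_inter_eq_empty] at hne
      exact h (.forced hA hB hvB hne)
  intro B hB B' hB'
  rcases mem_transport.1 hB with ⟨A, hA, rfl⟩ | ⟨hB, h⟩ <;>
    rcases mem_transport.1 hB' with ⟨A', hA', rfl⟩ | ⟨hB', h'⟩
  · exact ⟨v, mem_inter.2 ⟨self_mem_cSet, self_mem_cSet⟩⟩
  · exact mixed _ _ hA hB' h'
  · rw [inter_comm]
    exact mixed _ _ hA' hB h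
  · exact hI _ hB _ hB'

/-- A set that must be compressed is determined by the transported family. -/
theorem mustCompress_of_transport_eq (hv : v ∉ U) (hU : ∀ x ∈ U, f x ∈ U)
    (hf : ∀ x ∈ U, f (f x) = x) (hsub : 𝓕 ⊆ 𝓐) (hI : IsInter 𝓕)
    (heq : transport U v f 𝓐 𝓔 = transport U v f 𝓐 𝓕) (hA : MustCompress U v f 𝓐 𝓔 A) :
    MustCompress U v f 𝓐 𝓕 A := by
  have descend : ∀ B, MustCompress U v f 𝓐 𝓔 B → cSet U v f B ∉ 𝓕 →
      MustCompress U v f 𝓐 𝓕 B := by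
    intro B hB hC
    have hmem : cSet U v f B ∈ transport U v f 𝓐 𝓕 :=
      heq ▸ mem_transport.2 (Or.inl ⟨B, hB, rfl⟩)
    rcases mem_transport.1 hmem with ⟨D, hD, hDB⟩ | ⟨h, _⟩
    · exact cSet_injective hv hU hf hD.notMem hB.notMem hDB ▸ hD
    · exact absurd h hC
  induction hA with
  | moved hA hvA hC => exact descend _ (.moved hA hvA hC) fun h => hC (hsub h)
  | forced hA hB hvB hd ih =>
    exact descend _ (.forced hA hB hvB hd) fun h =>
      hI.not_disjoint ih.mem h (disjoint_cSet_comm hU hf hA.notMem hd)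

theorem subset_of_transport_eq (hv : v ∉ U) (hU : ∀ x ∈ U, f x ∈ U)
    (hf : ∀ x ∈ U, f (f x) = x) (hsub : 𝓔 ⊆ 𝓐) (hI : IsInter 𝓔) (hsub' : 𝓕 ⊆ 𝓐)
    (hI' : IsInter 𝓕) (heq : transport U v f 𝓐 𝓔 = transport U v f 𝓐 𝓕) : 𝓔 ⊆ 𝓕 := by
  intro A hA
  by_cases h : MustCompress U v f 𝓐 𝓔 A
  · exact (mustCompress_of_transport_eq hv hU hf hsub' hI' heq h).mem
  · have hmem : A ∈ transport U v f 𝓐 𝓕 := heq ▸ mem_transport.2 (Or.inr ⟨hA, h⟩)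
    rcases mem_transport.1 hmem with ⟨D, hD, rfl⟩ | ⟨h, _⟩
    · exact absurd hA
        ((mustCompress_of_transport_eq hv hU hf hsub hI heq.symm hD).cSet_notMem hU hf hsub hI)
    · exact h

theorem mem_interFams_s13 {s : ℕ} : 𝓔 ∈ interFams s 𝓐 ↔ (𝓔 ⊆ 𝓐 ∧ 𝓔.card = s) ∧ IsInter 𝓔 := by
  simp [interFams, IsInter, mem_powersetCard]

/-- A compression strictly increases the number of intersecting subfamilies of size `s` as soon as
`C(𝓐)` has one containing a new set `C(A)` and a set avoiding `v` that is disjoint from `A`. -/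
theorem card_interFams_lt (hv : v ∉ U) (hU : ∀ x ∈ U, f x ∈ U) (hf : ∀ x ∈ U, f (f x) = x)
    {s : ℕ} (h𝓕 : 𝓕 ∈ interFams s (cFam U v f 𝓐)) (hvA : v ∉ A) (hA : cSet U v f A ∉ 𝓐)
    (hA𝓕 : cSet U v f A ∈ 𝓕) (hvB : v ∉ B) (hB𝓕 : B ∈ 𝓕) (hAB : Disjoint A B) :
    (interFams s 𝓐).card < (interFams s (cFam U v f 𝓐)).card := by
  have hinj : Set.InjOn (transport U v f 𝓐) (interFams s 𝓐) := by
    intro 𝓔 h𝓔 𝓖 h𝓖 heq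
    obtain ⟨⟨h1, _⟩, h2⟩ := mem_interFams_s13.1 h𝓔
    obtain ⟨⟨h3, _⟩, h4⟩ := mem_interFams_s13.1 h𝓖
    exact (subset_of_transport_eq hv hU hf h1 h2 h3 h4 heq).antisymm
      (subset_of_transport_eq hv hU hf h3 h4 h1 h2 heq.symm)
  rw [← card_image_of_injOn hinj]
  refine card_lt_card (Finset.ssubset_iff_of_subset ?_ |>.2 ⟨𝓕, h𝓕, ?_⟩)
  · intro 𝓖 h𝓖
    obtain ⟨𝓔, h𝓔, rfl⟩ := mem_image.1 h𝓖
    obtain ⟨⟨h1, h2⟩, h3⟩ := mem_interFams_s13.1 h𝓔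
    exact mem_interFams_s13.2 ⟨⟨transport_subset h1, (card_transport hv hU hf h1 h3).trans h2⟩,
      isInter_transport h3⟩
  · intro himg
    obtain ⟨𝓔, h𝓔, rfl⟩ := mem_image.1 himg
    obtain ⟨⟨h1, _⟩, h3⟩ := mem_interFams_s13.1 h𝓔
    have hA𝓔 : A ∈ 𝓔 := by
      rcases mem_transport.1 hA𝓕 with ⟨D, hD, hDA⟩ | ⟨h, _⟩
      · exact cSet_injective hv hU hf hD.notMem hvA hDA ▸ hD.mem
      · exact absurd (h1 h) hA
    have hB𝓔 : B ∈ 𝓔 := by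
      rcases mem_transport.1 hB𝓕 with ⟨D, hD, rfl⟩ | ⟨h, _⟩
      · exact absurd self_mem_cSet hvB
      · exact h
    exact h3.not_disjoint hA𝓔 hB𝓔 hAB

end Compression

/-- The subsets of `[2m]` of size more than `m`, or of size `m` and containing `p`. -/
def halfFam (m p : ℕ) : Finset (Finset ℕ) :=
  (allFams (2 * m)).filter fun A => m < A.card ∨ (A.card = m ∧ p ∈ A)

theorem mem_halfFam {m p : ℕ} {A : Finset ℕ} :
    A ∈ halfFam m p ↔ A ⊆ Finset.Icc 1 (2 * m) ∧ (m < A.card ∨ (A.card = m ∧ p ∈ A)) := by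
  simp [halfFam, allFams, groundSet]

theorem isInter_halfFam (m p : ℕ) : IsInter (halfFam m p) := by
  intro A hA B hB
  obtain ⟨hA, hA'⟩ := mem_halfFam.1 hA
  obtain ⟨hB, hB'⟩ := mem_halfFam.1 hB
  by_cases hp : p ∈ A ∧ p ∈ B
  · exact ⟨p, mem_inter.2 hp⟩
  · have h1 := card_le_card (union_subset hA hB)
    have h2 := card_union_add_card_inter A B
    rw [Nat.card_Icc] at h1
    rw [← card_pos]
    by_contra h3
    have h4 : A.card = m ∧ B.card = m := by omega
    rcases hA' with h | h
    · omega
    · rcases hB' with h' | h'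
      · omega
      · exact hp ⟨h.2, h'.2⟩

theorem two_pow_le_card_halfFam {m p : ℕ} (hm : 1 ≤ m) (hp : p ∈ Finset.Icc 1 (2 * m)) :
    2 ^ (2 * m - 1) ≤ (halfFam m p).card := by
  have hcover : (Finset.Icc 1 (2 * m)).powerset ⊆
      halfFam m p ∪ (halfFam m p).image fun A => Finset.Icc 1 (2 * m) \ A := by
    intro A hA
    rw [mem_powerset] at hA
    rw [mem_union]
    by_cases h : A ∈ halfFam m p
    · exact Or.inl h
    · refine Or.inr (mem_image.2 ⟨Finset.Icc 1 (2 * m) \ A, ?_, Finset.sdiff_sdiff_eq_self hA⟩)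
      rw [mem_halfFam] at h ⊢
      have h1 := card_sdiff_add_card_eq_card hA
      rw [Nat.card_Icc] at h1
      refine ⟨sdiff_subset, ?_⟩
      by_cases h2 : p ∈ A
      · simp only [hA, h2, true_and, and_true] at h
        exact Or.inl (by omega)
      · have h3 : p ∈ Finset.Icc 1 (2 * m) \ A := mem_sdiff.2 ⟨hp, h2⟩
        simp only [hA, true_and] at h
        by_cases h4 : A.card = m
        · exact Or.inr ⟨by omega, h3⟩
        · exact Or.inl (by omega)
  have h1 := (card_le_card hcover).trans (card_union_le _ _)
  have h2 : ((halfFam m p).image fun A => Finset.Icc 1 (2 * m) \ A).card ≤ _ := card_image_le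
  rw [card_powerset, Nat.card_Icc] at h1
  have h3 : 2 ^ (2 * m + 1 - 1) = 2 * 2 ^ (2 * m - 1) := by
    rw [← pow_succ']
    congr 1
    omega
  omega

/-- The involution exchanging `i` and `m + i` for `1 ≤ i < m`. -/
def halfSwap (m x : ℕ) : ℕ := if x < m then x + m else x - m

theorem isUVF_halfSwap {m : ℕ} (hm : 1 ≤ m) :
    IsUVF (2 * m) ((Finset.Icc 1 (2 * m - 1)).erase m) (2 * m) (halfSwap m) := by
  refine ⟨?_, ?_, ?_, ?_, ?_, ?_, ?_⟩
  · intro x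
    simp only [mem_erase, mem_Icc]
    omega
  · rw [card_erase_of_mem (by simp only [mem_Icc]; omega), Nat.card_Icc]
    exact ⟨m - 1, by omega⟩
  · simp only [mem_Icc]
    omega
  · simp only [mem_erase, mem_Icc]
    omega
  all_goals
    intro x
    simp only [mem_erase, mem_Icc, halfSwap]
    split_ifs <;> omega

theorem stmt13 (n s ℓ : ℕ) (hn : 4 ≤ n) (heven : Even n)
    (hs1 : 2 ≤ s) (hs2 : s ≤ 2 ^ (n - 1)) (hℓ : ℓ = n / 2 - 1)
    (𝓐 : Finset (Finset ℕ)) (h𝓐 : 𝓐 ⊆ allFams n)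
    (hsub : (layerGE n (ℓ + 1)).erase (Finset.Icc (n - ℓ) n) ⊆ 𝓐)
    (hnotin : Finset.Icc (n - ℓ) n ∉ 𝓐) (hin : Finset.Icc 1 ℓ ∈ 𝓐) :
    ∃ (U : Finset ℕ) (v : ℕ) (f : ℕ → ℕ), IsUVF n U v f ∧
      (interFams s 𝓐).card < (interFams s (cFam U v f 𝓐)).card := by
  obtain ⟨m, hm⟩ := heven
  obtain rfl : n = 2 * m := by omega
  obtain rfl : ℓ = m - 1 := by omega
  have hm1 : 1 ≤ m := by omega
  have huvf := isUVF_halfSwap hm1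
  refine ⟨_, _, _, huvf, ?_⟩
  obtain ⟨hUn, -, hvn, hv, hU, hf, -⟩ := huvf
  set U := (Finset.Icc 1 (2 * m - 1)).erase m with hUdef
  have hlow : 2 * m ∉ Finset.Icc 1 (m - 1) := by
    simp only [mem_Icc]
    omega
  have hC : cSet U (2 * m) (halfSwap m) (Finset.Icc 1 (m - 1)) =
      Finset.Icc (2 * m - (m - 1)) (2 * m) := by
    ext x
    rw [mem_cSet hU hf, hUdef]
    simp only [mem_erase, mem_Icc, halfSwap]
    split_ifs <;> omega
  have hlarge : ∀ A ⊆ Finset.Icc 1 (2 * m), m ≤ A.card →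
      A ≠ Finset.Icc (2 * m - (m - 1)) (2 * m) → A ∈ 𝓐 := by
    intro A hA hcard hne
    apply hsub
    simp only [mem_erase, layerGE, allFams, groundSet, mem_filter, mem_powerset]
    exact ⟨hne, hA, by omega⟩
  have hhalf : halfFam m (m + 1) ⊆ cFam U (2 * m) (halfSwap m) 𝓐 := by
    intro A hA
    obtain ⟨hA, hA'⟩ := mem_halfFam.1 hA
    by_cases hne : A = Finset.Icc (2 * m - (m - 1)) (2 * m)
    · rw [hne, ← hC]
      exact cSet_mem_cFam hin hlow
    · refine mem_cFam_of_mem (hlarge A hA (by omega) hne) ?_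
      by_cases hvA : 2 * m ∈ A
      · exact Or.inl hvA
      · have hlt := card_lt_card_cSet hv hf hU hvA
        refine Or.inr (hlarge _ ?_ (by omega) ?_)
        · intro x hx
          rw [mem_cSet hU hf] at hx
          rcases hx with rfl | ⟨_, h⟩ | ⟨h, _⟩
          exacts [hvn, hA h, hUn h]
        · intro h
          rw [h, Nat.card_Icc] at hlt
          omega
  have hX : Finset.Icc (2 * m - (m - 1)) (2 * m) ∈ halfFam m (m + 1) := by
    refine mem_halfFam.2 ⟨Icc_subset_Icc (by omega) le_rfl, Or.inr ⟨?_, ?_⟩⟩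
    · rw [Nat.card_Icc]
      omega
    · simp only [mem_Icc]
      omega
  have hY : Finset.Icc m (2 * m - 1) ∈ halfFam m (m + 1) := by
    refine mem_halfFam.2 ⟨Icc_subset_Icc (by omega) (by omega), Or.inr ⟨?_, ?_⟩⟩
    · rw [Nat.card_Icc]
      omega
    · simp only [mem_Icc]
      omega
  have hpair : ({Finset.Icc (2 * m - (m - 1)) (2 * m), Finset.Icc m (2 * m - 1)} :
      Finset (Finset ℕ)) ⊆ halfFam m (m + 1) := by
    simp [insert_subset_iff, hX, hY]
  obtain ⟨𝓕, h1, h2, h3⟩ := exists_subsuperset_card_eq hpair (card_le_two.trans hs1)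
    (hs2.trans (two_pow_le_card_halfFam hm1 (by simp only [mem_Icc]; omega)))
  refine card_interFams_lt hv hU hf (𝓕 := 𝓕) (A := Finset.Icc 1 (m - 1))
    (B := Finset.Icc m (2 * m - 1)) ?_ hlow (hC ▸ hnotin) ?_ ?_ ?_ ?_
  · exact mem_interFams_s13.2 ⟨⟨h2.trans hhalf, h3⟩,
      fun A hA B hB => isInter_halfFam m (m + 1) A (h2 hA) B (h2 hB)⟩
  · rw [hC]
    exact h1 (mem_insert_self _ _)
  · simp only [mem_Icc]
    omega
  · exact h1 (mem_insert_of_mem (mem_singleton_self _))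
  · rw [Finset.disjoint_left]
    intro x
    simp only [mem_Icc]
    omega
end
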